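/- Let M = (M_j)_{j≥0} be a strongly regular sequence, let n ≥ 1, and let X be a real-analytic submanifold of an open neighborhood of the origin in ℝⁿ with 0 ∈ X. Then every C_M germ flat on X is a product of two such germs: if u is of class C_M on a neighborhood of 0 and flat on X, then there exist an open neighborhood U of 0 and functions v, w of class C_M on U, both flat on X ∩ U, such that u = v · w on U. (In germ language: m^∞_{X,M} = m^∞_{X,M} · m^∞_{X,M}.) -/

import Mathlib

noncomputable section

open Filter MeasureTheory
open scoped Topology

def StronglyRegularWith (M : ℕ → ℝ) (A : ℝ) : Prop :=
  (∀ j, 0 < M j) ∧ M 0 = 1 ∧ Monotone M ∧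
  (∀ j : ℕ, M (j + 1) * M (j + 1) ≤ M j * M (j + 2)) ∧
  1 ≤ A ∧
  (∀ j k : ℕ, M (j + k) ≤ A ^ (j + k) * (M j * M k)) ∧
  (∀ ℓ N : ℕ, ∑ j ∈ Finset.range N,
      M (ℓ + j) / (((ℓ + j : ℕ) + 1 : ℝ) * M (ℓ + j + 1)) ≤ A * (M ℓ / M (ℓ + 1)))

def StronglyRegular (M : ℕ → ℝ) : Prop := ∃ A : ℝ, StronglyRegularWith M A

noncomputable def hfn (M : ℕ → ℝ) (t : ℝ) : ℝ :=
  if t = 0 then 0 else ⨅ j : ℕ, t ^ j * M j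

def PropertyP (M : ℕ → ℝ) (γ : ℝ) : Prop :=
  ∃ (m' : ℕ → ℝ) (a : ℝ), 1 ≤ a ∧ (∀ j, 0 < m' j) ∧
    (Monotone fun j : ℕ => ((j : ℝ) + 1) ^ (-γ) * m' j) ∧
    (∀ j : ℕ, a⁻¹ * (M (j + 1) / M j) ≤ m' j ∧ m' j ≤ a * (M (j + 1) / M j))

noncomputable def growthIndex (M : ℕ → ℝ) : ℝ :=
  sSup {γ : ℝ | 0 < γ ∧ PropertyP M γ}

def Sector (γ : ℝ) : Set ℂ :=
  {z : ℂ | z ≠ 0 ∧ |Complex.arg z| < γ * Real.pi / 2}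

noncomputable def mixedPartial {n : ℕ} {F : Type*} [NormedAddCommGroup F] [NormedSpace ℝ F]
    (S : Set (EuclideanSpace ℝ (Fin n))) (f : EuclideanSpace ℝ (Fin n) → F)
    (k : ℕ) (e : Fin k → Fin n) (x : EuclideanSpace ℝ (Fin n)) : F :=
  iteratedFDerivWithin ℝ k f S x fun i => EuclideanSpace.single (e i) 1

/-- `f` is of class `C_M` on the open set `S`: it is `C^∞` on `S` and all its mixed
partial derivatives on `S` satisfy bounds `C σ^k k! M_k`. -/
def ClassCMOn {n : ℕ} (M : ℕ → ℝ) (S : Set (EuclideanSpace ℝ (Fin n)))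
    (f : EuclideanSpace ℝ (Fin n) → ℂ) : Prop :=
  ContDiffOn ℝ (⊤ : ℕ∞) f S ∧
    ∃ C σ : ℝ, 0 < C ∧ 0 < σ ∧ ∀ (k : ℕ) (e : Fin k → Fin n), ∀ x ∈ S,
      ‖mixedPartial S f k e x‖ ≤ C * σ ^ k * (Nat.factorial k : ℝ) * M k

/-- `f` is flat on `X` (derivatives computed on `S`): all mixed partial derivatives of
`f` vanish at every point of `X`. -/
def FlatOn {n : ℕ} (S X : Set (EuclideanSpace ℝ (Fin n)))
    (f : EuclideanSpace ℝ (Fin n) → ℂ) : Prop :=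
  ∀ x ∈ X, ∀ (k : ℕ) (e : Fin k → Fin n), mixedPartial S f k e x = 0

/-- `X` is a real-analytic submanifold: near each of its points it is straightened to a
linear subspace by a real-analytic local diffeomorphism. -/
def IsAnalyticSubmanifold {n : ℕ} (X : Set (EuclideanSpace ℝ (Fin n))) : Prop :=
  ∀ x ∈ X, ∃ (U W : Set (EuclideanSpace ℝ (Fin n)))
      (φ ψ : EuclideanSpace ℝ (Fin n) → EuclideanSpace ℝ (Fin n))
      (V : Submodule ℝ (EuclideanSpace ℝ (Fin n))),
    IsOpen U ∧ x ∈ U ∧ IsOpen W ∧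
    AnalyticOnNhd ℝ φ U ∧ AnalyticOnNhd ℝ ψ W ∧
    Set.MapsTo φ U W ∧ Set.MapsTo ψ W U ∧
    (∀ y ∈ U, ψ (φ y) = y) ∧ (∀ y ∈ W, φ (ψ y) = y) ∧
    φ '' (X ∩ U) = (V : Set (EuclideanSpace ℝ (Fin n))) ∩ W

/-- The quotients `M_{j+1} / M_j` of a sequence. -/
def quotientSeq (M : ℕ → ℝ) (j : ℕ) : ℝ := M (j + 1) / M j

namespace StronglyRegularWith

variable {M : ℕ → ℝ} {A : ℝ}

lemma quotientSeq_pos (hM : StronglyRegularWith M A) (j : ℕ) : 0 < quotientSeq M j :=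
  div_pos (hM.1 _) (hM.1 _)

lemma succ_eq (hM : StronglyRegularWith M A) (j : ℕ) : M (j + 1) = M j * quotientSeq M j := by
  have := hM.1 j
  unfold quotientSeq
  field_simp

lemma quotientSeq_mono (hM : StronglyRegularWith M A) : Monotone (quotientSeq M) := by
  refine monotone_nat_of_le_succ fun j => ?_
  unfold quotientSeq
  rw [div_le_div_iff₀ (hM.1 _) (hM.1 _)]
  linarith [hM.2.2.2.1 j]

lemma mul_quotientSeq_pow_le (hM : StronglyRegularWith M A) (j k : ℕ) :
    M j * quotientSeq M j ^ k ≤ M (j + k) := by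
  induction k with
  | zero => simp
  | succ k ih =>
    rw [← add_assoc, hM.succ_eq (j + k), pow_succ, ← mul_assoc]
    exact mul_le_mul ih (hM.quotientSeq_mono (Nat.le_add_right j k)) (hM.quotientSeq_pos j).le
      (hM.1 _).le

lemma mul_le (hM : StronglyRegularWith M A) (j k : ℕ) : M j * M k ≤ M (j + k) := by
  induction k with
  | zero => simp [hM.2.1]
  | succ k ih =>
    rw [← add_assoc, hM.succ_eq (j + k), hM.succ_eq k, ← mul_assoc]
    exact mul_le_mul ih (hM.quotientSeq_mono (Nat.le_add_left k j)) (hM.quotientSeq_pos k).le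
      (hM.1 _).le

lemma quotientSeq_pow_le (hM : StronglyRegularWith M A) (j : ℕ) :
    quotientSeq M j ^ j ≤ A ^ (2 * j) * M j := by
  have h1 := hM.mul_quotientSeq_pow_le j j
  have h2 := hM.2.2.2.2.2.1 j j
  have h3 : M j * quotientSeq M j ^ j ≤ M j * (A ^ (2 * j) * M j) := by
    rw [two_mul]; linarith
  exact le_of_mul_le_mul_left h3 (hM.1 j)

/-- Iterated moderate growth. -/
lemma moderate_growth_iterate (hM : StronglyRegularWith M A) (s i k : ℕ) :
    M (s * i + k) ≤ (A ^ s) ^ (s * i + k) * (M i ^ s * M k) := by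
  have hA := hM.2.2.2.2.1
  induction s with
  | zero => simp
  | succ s ih =>
    have hi := (hM.1 i).le
    have hk := (hM.1 k).le
    have e : (s + 1) * i + k = i + (s * i + k) := by ring
    calc M ((s + 1) * i + k) = M (i + (s * i + k)) := by rw [e]
      _ ≤ A ^ (i + (s * i + k)) * (M i * M (s * i + k)) := hM.2.2.2.2.2.1 _ _
      _ ≤ A ^ (i + (s * i + k)) * (M i * ((A ^ s) ^ (i + (s * i + k)) * (M i ^ s * M k))) := by
        gcongr
        refine ih.trans ?_
        exact mul_le_mul_of_nonneg_right
          (pow_le_pow_right₀ (one_le_pow₀ hA) (Nat.le_add_left _ _)) (by positivity)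
      _ = (A ^ (s + 1)) ^ ((s + 1) * i + k) * (M i ^ (s + 1) * M k) := by
        rw [e, pow_succ A s, mul_pow (A ^ s) A, pow_succ (M i) s]; ring

lemma log_le_sum_inv (ℓ N : ℕ) :
    Real.log (((ℓ : ℝ) + N + 1) / (ℓ + 1)) ≤
      ∑ j ∈ Finset.range N, 1 / (((ℓ + j : ℕ) : ℝ) + 1) := by
  induction N with
  | zero => simp [div_self (by positivity : (ℓ : ℝ) + 1 ≠ 0)]
  | succ N ih =>
    rw [Finset.sum_range_succ]
    have h : ((ℓ : ℝ) + (N + 1 : ℕ) + 1) / (ℓ + 1)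
        = (((ℓ : ℝ) + N + 1) / (ℓ + 1)) * (((ℓ : ℝ) + N + 1 + 1) / (ℓ + N + 1)) := by
      push_cast; field_simp; ring
    rw [h, Real.log_mul (by positivity) (by positivity)]
    have h2 := Real.log_le_sub_one_of_pos
      (by positivity : 0 < (((ℓ : ℝ) + N + 1 + 1) / (ℓ + N + 1)))
    have h3 : (((ℓ : ℝ) + N + 1 + 1) / (ℓ + N + 1)) - 1 = 1 / (((ℓ + N : ℕ) : ℝ) + 1) := by
      push_cast; field_simp; ring
    linarith

/-- The quotients double along a geometric scale of indices. -/
lemma exists_two_mul_quotientSeq_le (hM : StronglyRegularWith M A) :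
    ∃ Q : ℕ, 1 ≤ Q ∧ ∀ ℓ i : ℕ, Q * (ℓ + 1) ≤ i → 2 * quotientSeq M ℓ ≤ quotientSeq M i := by
  have hA := hM.2.2.2.2.1
  obtain ⟨Q, hQ⟩ := exists_nat_ge (Real.exp (2 * A))
  have hQ1 : 1 ≤ Q := by
    have : (1 : ℝ) ≤ Q := (Real.one_le_exp (by linarith)).trans hQ
    exact_mod_cast this
  refine ⟨Q, hQ1, fun ℓ i hi => ?_⟩
  have hli : ℓ ≤ i := by nlinarith
  set N := i - ℓ with hN
  have hiN : i = ℓ + N := by omega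
  have h1 := hM.2.2.2.2.2.2 ℓ N
  have h2 := log_le_sum_inv ℓ N
  have h3 : (2 * A) ≤ Real.log (((ℓ : ℝ) + N + 1) / (ℓ + 1)) := by
    rw [Real.le_log_iff_exp_le (by positivity), le_div_iff₀ (by positivity)]
    have : (Q : ℝ) * (ℓ + 1) ≤ ℓ + N := by
      rw [hiN] at hi; exact_mod_cast hi
    nlinarith
  have hmi := hM.quotientSeq_pos i
  have hml := hM.quotientSeq_pos ℓ
  have h4 : (∑ j ∈ Finset.range N, 1 / (((ℓ + j : ℕ) : ℝ) + 1)) * (1 / quotientSeq M i) ≤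
      ∑ j ∈ Finset.range N, M (ℓ + j) / (((ℓ + j : ℕ) + 1 : ℝ) * M (ℓ + j + 1)) := by
    rw [Finset.sum_mul]
    refine Finset.sum_le_sum fun j hj => ?_
    have hj' : ℓ + j ≤ i := by have := Finset.mem_range.1 hj; omega
    have h5 := hM.quotientSeq_mono hj'
    have hp := hM.quotientSeq_pos (ℓ + j)
    have e : M (ℓ + j) / (((ℓ + j : ℕ) + 1 : ℝ) * M (ℓ + j + 1))
      = 1 / (((ℓ + j : ℕ) : ℝ) + 1) * (1 / quotientSeq M (ℓ + j)) := by
      rw [hM.succ_eq (ℓ + j)]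
      have := (hM.1 (ℓ + j)).ne'
      field_simp
    rw [e]
    gcongr
  have h6 : A * (M ℓ / M (ℓ + 1)) = A * (1 / quotientSeq M ℓ) := by
    unfold quotientSeq; rw [one_div_div]
  have h7 : (2 * A) * (1 / quotientSeq M i) ≤ A * (1 / quotientSeq M ℓ) := by
    rw [← h6]
    refine le_trans ?_ (h4.trans h1)
    gcongr
    exact h3.trans h2
  rw [mul_one_div, mul_one_div, div_le_div_iff₀ hmi hml] at h7
  have : A * (2 * quotientSeq M ℓ) ≤ A * quotientSeq M i := by linarith
  exact le_of_mul_le_mul_left this (by linarith)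

/-- A power of the quotients grows at least quadratically. -/
lemma exists_quadratic_growth (hM : StronglyRegularWith M A) :
    ∃ (r : ℕ) (C : ℝ), 1 ≤ r ∧ 0 < C ∧ ∀ i j : ℕ, j ≤ i →
      ((i : ℝ) + 1) ^ 2 * quotientSeq M j ^ (2 * r) ≤
        C * ((j : ℝ) + 1) ^ 2 * quotientSeq M i ^ (2 * r) := by
  obtain ⟨Q, hQ1, hQ⟩ := hM.exists_two_mul_quotientSeq_le
  have hQ1' : (1 : ℝ) ≤ Q := by exact_mod_cast hQ1
  set r : ℕ := 2 * Q with hr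
  have hpow : (2 * (Q : ℝ)) ^ 2 ≤ 2 ^ (2 * r) := by
    have h1 : r < 2 ^ r := Nat.lt_two_pow_self
    have h2 : (r : ℝ) ≤ 2 ^ r := by exact_mod_cast h1.le
    have h3 : 2 * (Q : ℝ) ≤ 2 ^ r := by rw [hr] at h2 ⊢; push_cast at h2; exact h2
    calc (2 * (Q : ℝ)) ^ 2 ≤ (2 ^ r) ^ 2 := by gcongr
      _ = 2 ^ (2 * r) := by rw [← pow_mul, mul_comm]
  refine ⟨r, (2 * Q) ^ 2, by omega, by positivity, fun i j => ?_⟩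
  induction i using Nat.strong_induction_on with
  | _ i ih =>
    intro hji
    have hmj := hM.quotientSeq_pos j
    by_cases hi : i < Q * (j + 1)
    · have h1 := hM.quotientSeq_mono hji
      have h2 : ((i : ℝ) + 1) ≤ 2 * Q * (j + 1) := by
        have : (i : ℝ) + 1 ≤ Q * (j + 1) := by exact_mod_cast hi
        nlinarith
      calc ((i : ℝ) + 1) ^ 2 * quotientSeq M j ^ (2 * r)
          ≤ (2 * Q * (j + 1)) ^ 2 * quotientSeq M i ^ (2 * r) := by gcongr
        _ = _ := by ring
    · push Not at hi
      set i' := i / Q - 1 with hi'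
      have hdiv : j + 1 ≤ i / Q := by
        rw [Nat.le_div_iff_mul_le (by omega)]; linarith
      have hi'1 : i' + 1 = i / Q := by omega
      have h1 : Q * (i' + 1) ≤ i := by rw [hi'1]; exact Nat.mul_div_le i Q
      have h2 : i < Q * (i' + 1 + 1) := by
        rw [hi'1]; exact Nat.lt_mul_div_succ i (by omega)
      have hlt : i' < i := by nlinarith
      have h3 := ih i' hlt (by omega)
      have h4 := hQ i' i h1
      have h5 : ((i : ℝ) + 1) ≤ 2 * Q * (i' + 1) := by
        have : (i : ℝ) + 1 ≤ Q * (i' + 1 + 1) := by exact_mod_cast h2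
        nlinarith [(Nat.cast_nonneg i' : (0 : ℝ) ≤ i')]
      have hmi := hM.quotientSeq_pos i'
      calc ((i : ℝ) + 1) ^ 2 * quotientSeq M j ^ (2 * r)
          ≤ (2 * Q * (i' + 1)) ^ 2 * quotientSeq M j ^ (2 * r) := by gcongr
        _ = (2 * Q) ^ 2 * (((i' : ℝ) + 1) ^ 2 * quotientSeq M j ^ (2 * r)) := by ring
        _ ≤ 2 ^ (2 * r) * ((2 * Q) ^ 2 * ((j : ℝ) + 1) ^ 2 * quotientSeq M i' ^ (2 * r)) := by
          gcongr
        _ = (2 * Q) ^ 2 * ((j : ℝ) + 1) ^ 2 * (2 * quotientSeq M i') ^ (2 * r) := by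
          rw [mul_pow]; ring
        _ ≤ _ := by gcongr

lemma exists_one_lt_mul_quotientSeq (hM : StronglyRegularWith M A) {t : ℝ} (ht : 0 < t) :
    ∃ j, 1 < t * quotientSeq M j := by
  obtain ⟨Q, -, hQ⟩ := hM.exists_two_mul_quotientSeq_le
  have h0 := hM.quotientSeq_pos 0
  have key : ∀ s : ℕ, ∃ j, 2 ^ s * quotientSeq M 0 ≤ quotientSeq M j := by
    intro s
    induction s with
    | zero => exact ⟨0, by simp⟩
    | succ s ih =>
      obtain ⟨j, hj⟩ := ih
      refine ⟨Q * (j + 1), le_trans ?_ (hQ j _ le_rfl)⟩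
      rw [pow_succ]; linarith
  obtain ⟨s, hs⟩ := pow_unbounded_of_one_lt (1 / (t * quotientSeq M 0)) (one_lt_two)
  obtain ⟨j, hj⟩ := key s
  refine ⟨j, ?_⟩
  rw [div_lt_iff₀ (by positivity)] at hs
  calc 1 < t * (2 ^ s * quotientSeq M 0) := by linarith
    _ ≤ _ := by gcongr

end StronglyRegularWith

open Classical in
/-- The first index `j` with `1 < t * M_{j+1} / M_j`. -/
def critIndex (M : ℕ → ℝ) (t : ℝ) : ℕ :=
  if h : ∃ j, 1 < t * quotientSeq M j then Nat.find h else 0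

namespace StronglyRegularWith

variable {M : ℕ → ℝ} {A : ℝ}

lemma one_lt_of_critIndex_le (hM : StronglyRegularWith M A) {t : ℝ} (ht : 0 < t) {i : ℕ}
    (hi : critIndex M t ≤ i) : 1 < t * quotientSeq M i := by
  classical
  have h := hM.exists_one_lt_mul_quotientSeq ht
  have h1 : 1 < t * quotientSeq M (critIndex M t) := by
    rw [critIndex, dif_pos h]; exact Nat.find_spec h
  refine h1.trans_le ?_
  gcongr
  exact hM.quotientSeq_mono hi

lemma le_one_of_lt_critIndex {t : ℝ} {i : ℕ}
    (hi : i < critIndex M t) : t * quotientSeq M i ≤ 1 := by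
  classical
  unfold critIndex at hi
  split_ifs at hi with h
  · exact not_lt.1 (Nat.find_min h hi)
  · omega

/-- Lower bound for the weight `t ^ k * M k` in terms of the critical index. -/
lemma inv_pow_critIndex_le (hM : StronglyRegularWith M A) {t : ℝ} (ht : 0 < t) (k : ℕ) :
    (A ^ (2 * critIndex M t))⁻¹ ≤ t ^ k * M k := by
  set j := critIndex M t with hj
  have hA := hM.2.2.2.2.1
  have hmj := hM.quotientSeq_pos j
  have hMj := hM.1 j
  have h1 : (A ^ (2 * j))⁻¹ ≤ t ^ j * M j := by
    rw [inv_le_iff_one_le_mul₀ (by positivity)]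
    have h2 := hM.quotientSeq_pow_le j
    have h3 : 1 ≤ (t * quotientSeq M j) ^ j :=
      one_le_pow₀ (hM.one_lt_of_critIndex_le ht le_rfl).le
    rw [mul_pow] at h3
    calc 1 ≤ t ^ j * quotientSeq M j ^ j := h3
      _ ≤ t ^ j * (A ^ (2 * j) * M j) := by gcongr
      _ = _ := by ring
  refine h1.trans ?_
  rcases le_total j k with h | h
  · obtain ⟨d, rfl⟩ := Nat.exists_eq_add_of_le h
    have h2 := hM.mul_quotientSeq_pow_le j d
    have h3 : 1 ≤ (t * quotientSeq M j) ^ d :=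
      one_le_pow₀ (hM.one_lt_of_critIndex_le ht le_rfl).le
    rw [mul_pow] at h3
    calc t ^ j * M j ≤ t ^ j * M j * (t ^ d * quotientSeq M j ^ d) :=
          le_mul_of_one_le_right (by positivity) h3
      _ = t ^ (j + d) * (M j * quotientSeq M j ^ d) := by ring
      _ ≤ _ := by gcongr
  · refine Nat.decreasingInduction' (P := fun k => t ^ j * M j ≤ t ^ k * M k) ?_ h le_rfl
    intro k hk _ ih
    refine ih.trans ?_
    have h2 := le_one_of_lt_critIndex (M := M) (t := t) hk
    have hMk := hM.1 k
    rw [hM.succ_eq]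
    calc t ^ (k + 1) * (M k * quotientSeq M k) = t ^ k * M k * (t * quotientSeq M k) := by ring
      _ ≤ t ^ k * M k * 1 := by gcongr
      _ = _ := mul_one _

lemma pow_mul_le_exp_neg (hM : StronglyRegularWith M A) {t : ℝ} (ht : 0 < t) :
    t ^ critIndex M (Real.exp 1 * t) * M (critIndex M (Real.exp 1 * t)) ≤
      Real.exp (-(critIndex M (Real.exp 1 * t) : ℝ)) := by
  have : ∀ j ≤ critIndex M (Real.exp 1 * t), t ^ j * M j ≤ Real.exp (-(j : ℝ)) := by
    intro j
    induction j with
    | zero => simp [hM.2.1]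
    | succ j ih =>
      intro hj
      have h1 := ih (by omega)
      have h2 := le_one_of_lt_critIndex (M := M) hj
      have h3 : t * quotientSeq M j ≤ Real.exp (-1) := by
        rw [Real.exp_neg, ← one_div, le_div_iff₀ (Real.exp_pos 1)]; linarith
      have hq := hM.quotientSeq_pos j
      rw [hM.succ_eq]
      calc t ^ (j + 1) * (M j * quotientSeq M j) = t ^ j * M j * (t * quotientSeq M j) := by ring
        _ ≤ Real.exp (-(j : ℝ)) * Real.exp (-1) := by gcongr
        _ = _ := by rw [← Real.exp_add]; congr 1; push_cast; ring
  exact this _ le_rfl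

/-- A quantity below every `t ^ i * M i` has room for an exponential factor in the critical
index, at the price of a dilation of `t`. -/
lemma le_exp_neg_mul (hM : StronglyRegularWith M A) (s : ℕ) {t a : ℝ} (ht : 0 < t)
    (ha : ∀ i, a ≤ t ^ i * M i) (k : ℕ) :
    a ≤ Real.exp (-(s * critIndex M (Real.exp 1 * (A ^ s * t)) : ℝ)) *
      ((A ^ s * t) ^ k * M k) := by
  have hA := hM.2.2.2.2.1
  set κ := A ^ s * t with hκ
  have hκ0 : 0 < κ := by positivity
  set i := critIndex M (Real.exp 1 * κ) with hi
  have h1 := hM.pow_mul_le_exp_neg hκ0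
  rw [← hi] at h1
  have hMi := hM.1 i
  have hMk := hM.1 k
  calc a ≤ t ^ (s * i + k) * M (s * i + k) := ha _
    _ ≤ t ^ (s * i + k) * ((A ^ s) ^ (s * i + k) * (M i ^ s * M k)) := by
      gcongr; exact hM.moderate_growth_iterate s i k
    _ = (κ ^ i * M i) ^ s * (κ ^ k * M k) := by
      have h2 : t ^ (s * i + k) * (A ^ s) ^ (s * i + k) = κ ^ (s * i + k) := by
        rw [← mul_pow, mul_comm t, hκ]
      rw [← mul_assoc, h2, pow_add, pow_mul', mul_pow (κ ^ i)]
      ring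
    _ ≤ Real.exp (-(i : ℝ)) ^ s * (κ ^ k * M k) := by gcongr
    _ = _ := by rw [← Real.exp_nat_mul]; congr 2; ring

end StronglyRegularWith

section WeightFunction

lemma norm_inv_one_add_mul_le {X : ℝ} (hX : 0 ≤ X) {δ : ℂ} (hδ : ‖δ - 1‖ ≤ 1 / 2) :
    1 + (X : ℂ) * δ ≠ 0 ∧ ‖1 / (1 + (X : ℂ) * δ)‖ ≤ 2 * (1 / (1 + X)) ∧
      2 / 9 * (1 / (1 + X)) ≤ (1 / (1 + (X : ℂ) * δ)).re := by
  set ω : ℂ := 1 + (X : ℂ) * δ with hω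
  have h1 : ω - (1 + X : ℝ) = X * (δ - 1) := by rw [hω]; push_cast; ring
  have h2 : ‖ω - (1 + X : ℝ)‖ ≤ X / 2 := by
    rw [h1, norm_mul, Complex.norm_real, Real.norm_of_nonneg hX]
    nlinarith
  have hre : (1 + X) / 2 ≤ ω.re := by
    have := (abs_le.1 ((Complex.abs_re_le_norm _).trans h2)).1
    rw [Complex.sub_re, Complex.ofReal_re] at this
    linarith
  have hup : ‖ω‖ ≤ 3 / 2 * (1 + X) := by
    have h3 := norm_le_norm_add_norm_sub ((1 + X : ℝ) : ℂ) ω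
    rw [Complex.norm_real, Real.norm_of_nonneg (by linarith), norm_sub_rev] at h3
    linarith
  have hlo : (1 + X) / 2 ≤ ‖ω‖ := hre.trans (Complex.re_le_norm ω)
  have hpos : 0 < ‖ω‖ := by linarith
  refine ⟨norm_pos_iff.1 hpos, ?_, ?_⟩
  · rw [norm_div, norm_one, mul_one_div, div_le_div_iff₀ hpos (by linarith)]
    linarith
  · rw [one_div ω, Complex.inv_re, Complex.normSq_eq_norm_sq, mul_one_div,
      div_le_div_iff₀ (by linarith) (by positivity)]
    have : ‖ω‖ ^ 2 ≤ (3 / 2 * (1 + X)) ^ 2 := by gcongr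
    nlinarith

lemma sum_range_le_of_le_div_sq {f : ℕ → ℝ} {C : ℝ} (hC : 0 ≤ C) {j : ℕ} (h1 : ∀ i, f i ≤ 1)
    (h2 : ∀ i, j ≤ i → f i ≤ C * (((j : ℝ) + 1) ^ 2 / ((i : ℝ) + 1) ^ 2)) (hf : ∀ i, 0 ≤ f i)
    (N : ℕ) : ∑ i ∈ Finset.range N, f i ≤ (2 * C + 1) * (j + 1) := by
  have h3 : ∀ d : ℕ, ∑ l ∈ Finset.range d, f (j + l) ≤
      2 * C * ((j : ℝ) + 1) ^ 2 * (1 / ((j : ℝ) + 1) - 1 / ((j : ℝ) + d + 1)) := by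
    intro d
    induction d with
    | zero => simp
    | succ d ih =>
      rw [Finset.sum_range_succ]
      have h4 := h2 (j + d) (Nat.le_add_right _ _)
      have h5 : (1 : ℝ) / (((j + d : ℕ) : ℝ) + 1) ^ 2 ≤
          2 * (1 / ((j : ℝ) + d + 1) - 1 / ((j : ℝ) + (d + 1 : ℕ) + 1)) := by
        push_cast
        rw [div_sub_div _ _ (by positivity) (by positivity), mul_div_assoc', div_le_div_iff₀
          (by positivity) (by positivity)]
        nlinarith [(by positivity : 0 ≤ ((j : ℝ) + d)), sq_nonneg ((j : ℝ) + d)]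
      have h6 : C * (((j : ℝ) + 1) ^ 2 / (((j + d : ℕ) : ℝ) + 1) ^ 2) ≤ C * ((j : ℝ) + 1) ^ 2 *
          (2 * (1 / ((j : ℝ) + d + 1) - 1 / ((j : ℝ) + (d + 1 : ℕ) + 1))) := by
        rw [mul_assoc, div_eq_mul_one_div]
        gcongr
      linarith
  calc ∑ i ∈ Finset.range N, f i ≤ ∑ i ∈ Finset.range (j + N), f i :=
        Finset.sum_le_sum_of_subset_of_nonneg (Finset.range_mono (by omega)) fun i _ _ => hf i
    _ = ∑ i ∈ Finset.range j, f i + ∑ l ∈ Finset.range N, f (j + l) :=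
        Finset.sum_range_add ..
    _ ≤ j + 2 * C * ((j : ℝ) + 1) ^ 2 * (1 / ((j : ℝ) + 1) - 1 / ((j : ℝ) + N + 1)) := by
        refine add_le_add ?_ (h3 N)
        exact (Finset.sum_le_sum fun i _ => h1 i).trans (by simp)
    _ ≤ j + 2 * C * ((j : ℝ) + 1) ^ 2 * (1 / ((j : ℝ) + 1)) := by
        gcongr
        simp only [tsub_le_iff_right, le_add_iff_nonneg_right]
        positivity
    _ = j + 2 * C * ((j : ℝ) + 1) := by field_simp
    _ ≤ _ := by linarith

variable {M : ℕ → ℝ} {A : ℝ}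

lemma StronglyRegularWith.exists_real_sum_bounds (hM : StronglyRegularWith M A) :
    ∃ (r : ℕ) (C : ℝ), 0 < C ∧ ∀ t : ℝ, 0 < t →
      Summable (fun i => 1 / (1 + (t ^ 2 * quotientSeq M i ^ 2) ^ r)) ∧
      (critIndex M t : ℝ) / 2 ≤ ∑' i, 1 / (1 + (t ^ 2 * quotientSeq M i ^ 2) ^ r) ∧
      ∑' i, 1 / (1 + (t ^ 2 * quotientSeq M i ^ 2) ^ r) ≤ C * (critIndex M t + 1) := by
  obtain ⟨r, C, hr, hC, h⟩ := hM.exists_quadratic_growth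
  refine ⟨r, 2 * C + 1, by positivity, fun t ht => ?_⟩
  set f : ℕ → ℝ := fun i => 1 / (1 + (t ^ 2 * quotientSeq M i ^ 2) ^ r) with hf
  set j := critIndex M t
  have hf0 : ∀ i, 0 ≤ f i := fun i => by
    have := hM.quotientSeq_pos i
    positivity
  have hf1 : ∀ i, f i ≤ 1 := fun i => by
    have := hM.quotientSeq_pos i
    exact div_le_one_of_le₀ (le_add_of_nonneg_right (by positivity)) (by positivity)
  have hf2 : ∀ i, j ≤ i → f i ≤ C * (((j : ℝ) + 1) ^ 2 / ((i : ℝ) + 1) ^ 2) := by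
    intro i hi
    have hmi := hM.quotientSeq_pos i
    have hmj := hM.quotientSeq_pos j
    have h1 := h i j hi
    have h2 : 1 ≤ (t * quotientSeq M j) ^ (2 * r) :=
      one_le_pow₀ (hM.one_lt_of_critIndex_le ht le_rfl).le
    have h3 : (t ^ 2 * quotientSeq M i ^ 2) ^ r = t ^ (2 * r) * quotientSeq M i ^ (2 * r) := by
      rw [mul_pow, ← pow_mul, ← pow_mul]
    have h4 : ((i : ℝ) + 1) ^ 2 ≤
        C * ((j : ℝ) + 1) ^ 2 * (t ^ 2 * quotientSeq M i ^ 2) ^ r := by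
      rw [h3]
      rw [mul_pow] at h2
      calc ((i : ℝ) + 1) ^ 2
          ≤ ((i : ℝ) + 1) ^ 2 * (t ^ (2 * r) * quotientSeq M j ^ (2 * r)) :=
            le_mul_of_one_le_right (by positivity) h2
        _ = t ^ (2 * r) * (((i : ℝ) + 1) ^ 2 * quotientSeq M j ^ (2 * r)) := by ring
        _ ≤ t ^ (2 * r) * (C * ((j : ℝ) + 1) ^ 2 * quotientSeq M i ^ (2 * r)) := by gcongr
        _ = _ := by ring
    rw [hf, mul_div_assoc', div_le_div_iff₀ (by positivity) (by positivity), one_mul]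
    refine h4.trans ?_
    gcongr
    linarith
  have hsum := sum_range_le_of_le_div_sq hC.le hf1 hf2 hf0
  have hS : Summable f := summable_of_sum_range_le hf0 hsum
  refine ⟨hS, ?_, Real.tsum_le_of_sum_range_le hf0 hsum⟩
  refine le_trans ?_ (hS.sum_le_tsum (Finset.range j) fun i _ => hf0 i)
  have : ∑ i ∈ Finset.range j, (1 / 2 : ℝ) ≤ ∑ i ∈ Finset.range j, f i := by
    refine Finset.sum_le_sum fun i hi => ?_
    have h1 := le_one_of_lt_critIndex (M := M) (Finset.mem_range.1 hi)
    have hmi := hM.quotientSeq_pos i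
    have h2 : (t ^ 2 * quotientSeq M i ^ 2) ^ r ≤ 1 := by
      rw [← mul_pow, ← pow_mul]
      exact pow_le_one₀ (by positivity) h1
    rw [hf]
    exact one_div_le_one_div_of_le (by positivity) (by linarith)
  simpa [hf, div_eq_mul_inv] using this

/-- A holomorphic function near the positive axis whose real part counts critical indices. -/
lemma StronglyRegularWith.exists_holomorphic_count (hM : StronglyRegularWith M A) :
    ∃ (c C : ℝ) (Λ : ℂ → ℂ), 0 < c ∧ c < 1 ∧ 0 < C ∧ ∀ t : ℝ, 0 < t →
      DifferentiableOn ℂ Λ (Metric.closedBall ((t : ℂ) ^ 2) (c * t ^ 2)) ∧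
      ∀ z ∈ Metric.closedBall ((t : ℂ) ^ 2) (c * t ^ 2),
        (critIndex M t : ℝ) / 9 ≤ (Λ z).re ∧ (Λ z).re ≤ C * (critIndex M t + 1) := by
  obtain ⟨r, C, hC, h⟩ := hM.exists_real_sum_bounds
  obtain ⟨c, hc0, hc⟩ : ∃ c > 0, ∀ ζ : ℂ, ‖ζ‖ < c → ‖(1 + ζ) ^ r - 1‖ ≤ 1 / 2 := by
    have h1 : ContinuousAt (fun ζ : ℂ => (1 + ζ) ^ r) 0 := by fun_prop
    obtain ⟨c, hc0, hc⟩ := Metric.continuousAt_iff.1 h1 (1 / 2) (by norm_num)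
    refine ⟨c, hc0, fun ζ hζ => ?_⟩
    have := hc (x := ζ) (by simpa using hζ)
    rw [dist_eq_norm] at this
    simpa using this.le
  set f : ℕ → ℂ → ℂ := fun i z => 1 / (1 + (z * (quotientSeq M i : ℂ) ^ 2) ^ r) with hf
  have key : ∀ t : ℝ, 0 < t → ∀ i, ∀ z ∈ Metric.ball ((t : ℂ) ^ 2) (c * t ^ 2),
      (1 + (z * (quotientSeq M i : ℂ) ^ 2) ^ r) ≠ 0 ∧
      ‖f i z‖ ≤ 2 * (1 / (1 + (t ^ 2 * quotientSeq M i ^ 2) ^ r)) ∧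
      2 / 9 * (1 / (1 + (t ^ 2 * quotientSeq M i ^ 2) ^ r)) ≤ (f i z).re := by
    intro t ht i z hz
    have ht' : (t : ℂ) ≠ 0 := by exact_mod_cast ht.ne'
    set ζ : ℂ := (z - t ^ 2) / t ^ 2 with hζ
    have hz' : z = (t : ℂ) ^ 2 * (1 + ζ) := by rw [hζ]; field_simp; ring
    have hζc : ‖ζ‖ < c := by
      rw [mem_ball_iff_norm] at hz
      rw [hζ, norm_div, norm_pow, Complex.norm_real, Real.norm_of_nonneg ht.le,
        div_lt_iff₀ (by positivity)]
      exact hz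
    have hX : 0 ≤ (t ^ 2 * quotientSeq M i ^ 2) ^ r := by positivity
    have e : (z * (quotientSeq M i : ℂ) ^ 2) ^ r
        = (((t ^ 2 * quotientSeq M i ^ 2) ^ r : ℝ) : ℂ) * (1 + ζ) ^ r := by
      rw [hz']; push_cast; rw [← mul_pow]; ring
    simp only [hf]
    rw [e]
    exact norm_inv_one_add_mul_le hX (hc ζ hζc)
  have hsub : ∀ t : ℝ, 0 < t → Metric.closedBall ((t : ℂ) ^ 2) (min (c / 2) (1 / 2) * t ^ 2) ⊆
      Metric.ball ((t : ℂ) ^ 2) (c * t ^ 2) := by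
    intro t ht
    refine Metric.closedBall_subset_ball ?_
    gcongr
    exact (min_le_left _ _).trans_lt (by linarith)
  refine ⟨min (c / 2) (1 / 2), 2 * C, fun z => ∑' i, f i z, by positivity,
    (min_le_right _ _).trans_lt (by norm_num), by positivity, fun t ht => ?_⟩
  obtain ⟨hS, hl, hu⟩ := h t ht
  have hS2 := hS.mul_left 2
  refine ⟨?_, fun z hz => ?_⟩
  · refine DifferentiableOn.mono ?_ (hsub t ht)
    refine Complex.differentiableOn_tsum_of_summable_norm hS2 (fun i => ?_) Metric.isOpen_ball
      fun i z hz => (key t ht i z hz).2.1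
    intro z hz
    have := (key t ht i z hz).1
    simp only [hf]
    fun_prop (disch := assumption)
  · have hz' := hsub t ht hz
    have hsf : Summable fun i => f i z :=
      Summable.of_norm_bounded hS2 fun i => (key t ht i z hz').2.1
    have hre : (∑' i, f i z).re = ∑' i, (f i z).re := Complex.re_tsum hsf
    have hsre : Summable fun i => (f i z).re := (Complex.hasSum_re hsf.hasSum).summable
    constructor
    · rw [hre]
      have := Summable.tsum_le_tsum (fun i => (key t ht i z hz').2.2) (hS.mul_left _) hsre
      rw [tsum_mul_left] at this
      linarith
    · rw [hre]
      have := Summable.tsum_le_tsum (fun i => (Complex.re_le_norm _).trans (key t ht i z hz').2.1)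
        hsre hS2
      rw [tsum_mul_left] at this
      linarith

/-- Flat holomorphic weights: `F` decays like an element of the class, while `F⁻¹` can be
absorbed by any quantity `a` below all `(τ t) ^ i * M i`. -/
lemma StronglyRegularWith.exists_flat_weight (hM : StronglyRegularWith M A) :
    ∃ c : ℝ, 0 < c ∧ c < 1 ∧ ∀ τ : ℝ, 0 < τ → ∃ (F : ℂ → ℂ) (κ C : ℝ), 0 < κ ∧ 0 < C ∧
      (∀ z, F z ≠ 0) ∧ ∀ t : ℝ, 0 < t →
      DifferentiableOn ℂ F (Metric.closedBall ((t : ℂ) ^ 2) (c * t ^ 2)) ∧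
      ∀ z ∈ Metric.closedBall ((t : ℂ) ^ 2) (c * t ^ 2),
        (∀ k : ℕ, ‖F z‖ ≤ C * ((κ * t) ^ k * M k * t ^ 2)) ∧
        ∀ a : ℝ, (∀ i : ℕ, a ≤ (τ * t) ^ i * M i) →
          ∀ k : ℕ, a * ‖(F z)⁻¹‖ ≤ C * ((κ * t) ^ k * M k * t ^ 2) := by
  obtain ⟨c, C, Λ, hc0, hc1, hC, h⟩ := hM.exists_holomorphic_count
  refine ⟨c, hc0, hc1, fun τ hτ => ?_⟩
  have hA := hM.2.2.2.2.1
  have hM2 := hM.1 2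
  set K : ℝ := 36 * Real.log A with hK
  have hK0 : 0 ≤ K := by have := Real.log_nonneg hA; positivity
  obtain ⟨s, hs⟩ := exists_nat_ge (K * C)
  set l : ℝ := Real.exp 1 * (A ^ s * τ) with hl
  have hl0 : 0 < l := by positivity
  set κ' : ℝ := A ^ (s + 1) * τ with hκ'
  have hκ'0 : 0 < κ' := by positivity
  refine ⟨fun z => Complex.exp (-(K * Λ ((l : ℂ) ^ 2 * z))), max l κ',
    max (l ^ 2 * M 2) (Real.exp (K * C) * (κ' ^ 2 * M 2)), by positivity, by positivity,
    fun z => Complex.exp_ne_zero _, fun t ht => ?_⟩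
  obtain ⟨hd, hb⟩ := h (l * t) (by positivity)
  have hmaps : Set.MapsTo (fun z : ℂ => (l : ℂ) ^ 2 * z)
      (Metric.closedBall ((t : ℂ) ^ 2) (c * t ^ 2))
      (Metric.closedBall (((l * t : ℝ) : ℂ) ^ 2) (c * (l * t) ^ 2)) := by
    intro z hz
    rw [mem_closedBall_iff_norm] at hz ⊢
    have e : (l : ℂ) ^ 2 * z - ((l * t : ℝ) : ℂ) ^ 2 = (l : ℂ) ^ 2 * (z - (t : ℂ) ^ 2) := by
      push_cast; ring
    rw [e, norm_mul, norm_pow, Complex.norm_real, Real.norm_of_nonneg hl0.le]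
    calc l ^ 2 * ‖z - (t : ℂ) ^ 2‖ ≤ l ^ 2 * (c * t ^ 2) := by gcongr
      _ = _ := by ring
  refine ⟨?_, fun z hz => ?_⟩
  · have h1 : DifferentiableOn ℂ (fun z => Λ ((l : ℂ) ^ 2 * z))
        (Metric.closedBall ((t : ℂ) ^ 2) (c * t ^ 2)) :=
      hd.comp (by fun_prop) hmaps
    exact ((h1.const_mul _).neg).cexp
  obtain ⟨hb1, hb2⟩ := hb _ (hmaps hz)
  set j := critIndex M (l * t) with hj
  have hre : (-((K : ℂ) * Λ ((l : ℂ) ^ 2 * z))).re = -(K * (Λ ((l : ℂ) ^ 2 * z)).re) := by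
    rw [Complex.neg_re, Complex.re_ofReal_mul]
  refine ⟨fun k => ?_, fun a ha k => ?_⟩
  · have hMk := hM.1 k
    rw [Complex.norm_exp, hre]
    have h1 := hM.inv_pow_critIndex_le (by positivity : 0 < l * t) k
    have h2 := hM.inv_pow_critIndex_le (by positivity : 0 < l * t) 2
    rw [← hj] at h1 h2
    have h3 : Real.exp (-(4 * j * Real.log A)) = (A ^ (2 * j))⁻¹ * (A ^ (2 * j))⁻¹ := by
      rw [← mul_inv, ← pow_add, Real.exp_neg, ← Real.exp_log (by linarith : 0 < A),
        ← Real.exp_nat_mul, Real.log_exp]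
      congr 2; push_cast; ring
    calc Real.exp (-(K * (Λ ((l : ℂ) ^ 2 * z)).re)) ≤ Real.exp (-(4 * j * Real.log A)) := by
          rw [Real.exp_le_exp, neg_le_neg_iff]
          have := mul_le_mul_of_nonneg_left hb1 hK0
          rw [hK] at this ⊢
          linarith
      _ = (A ^ (2 * j))⁻¹ * (A ^ (2 * j))⁻¹ := h3
      _ ≤ ((l * t) ^ k * M k) * ((l * t) ^ 2 * M 2) := by gcongr
      _ = (l ^ 2 * M 2) * ((l * t) ^ k * M k * t ^ 2) := by ring
      _ ≤ _ := by
        gcongr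
        · exact le_max_left _ _
        · exact le_max_left _ _
  · have hMk := hM.1 k
    rw [norm_inv, Complex.norm_exp, hre, Real.exp_neg, inv_inv]
    have h1 := hM.le_exp_neg_mul s (by positivity : 0 < τ * t) ha (k + 2)
    have e : Real.exp 1 * (A ^ s * (τ * t)) = l * t := by rw [hl]; ring
    rw [e, ← hj] at h1
    have h2 : Real.exp (K * (Λ ((l : ℂ) ^ 2 * z)).re) ≤
        Real.exp (K * C) * Real.exp (s * j) := by
      rw [← Real.exp_add, Real.exp_le_exp]
      have h3 := mul_le_mul_of_nonneg_left hb2 hK0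
      have h4 : K * C * j ≤ s * j := by gcongr
      linarith
    calc a * Real.exp (K * (Λ ((l : ℂ) ^ 2 * z)).re)
        ≤ (Real.exp (-(s * j : ℝ)) * ((A ^ s * (τ * t)) ^ (k + 2) * M (k + 2))) *
          Real.exp (K * (Λ ((l : ℂ) ^ 2 * z)).re) := by gcongr
      _ ≤ (Real.exp (-(s * j : ℝ)) * ((A ^ s * (τ * t)) ^ (k + 2) * (A ^ (k + 2) * (M k * M 2)))) *
          (Real.exp (K * C) * Real.exp (s * j)) := by
        have := hM.1 (k + 2)
        gcongr
        exact hM.2.2.2.2.2.1 k 2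
      _ = (Real.exp (K * C) * (κ' ^ 2 * M 2)) * ((κ' * t) ^ k * M k * t ^ 2) := by
        rw [Real.exp_neg, hκ']
        field_simp
        ring
      _ ≤ _ := by
        gcongr
        · exact le_max_right _ _
        · exact le_max_right _ _

end WeightFunction

section AnalyticEstimates

variable {E : Type*} [NormedAddCommGroup E] [NormedSpace ℝ E]

lemma FormalMultilinearSeries.norm_comp_le {F G : Type*} [NormedAddCommGroup F] [NormedSpace ℝ F]
    [NormedAddCommGroup G] [NormedSpace ℝ G] (P : FormalMultilinearSeries ℝ F G)
    (q : FormalMultilinearSeries ℝ E F) {B a D b : ℝ} (hB : 0 ≤ B) (ha : 0 ≤ a) (hD : 0 ≤ D)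
    (hb : 0 ≤ b) (hP : ∀ k, ‖P k‖ ≤ B * a ^ k) (hq : ∀ k, 1 ≤ k → ‖q k‖ ≤ D * b ^ k) (k : ℕ) :
    ‖P.comp q k‖ ≤ B * (2 * max 1 (a * D) * b) ^ k := by
  have hm : 1 ≤ max 1 (a * D) := le_max_left _ _
  have h1 : ∀ c : Composition k, ‖P.compAlongComposition q c‖ ≤ B * (max 1 (a * D) * b) ^ k := by
    intro c
    have hprod : ∏ i, ‖q (c.blocksFun i)‖ ≤ D ^ c.length * b ^ k := by
      calc ∏ i, ‖q (c.blocksFun i)‖ ≤ ∏ i, D * b ^ c.blocksFun i :=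
            Finset.prod_le_prod (fun _ _ => norm_nonneg _)
              fun i _ => hq _ (c.one_le_blocksFun i)
        _ = _ := by
          rw [Finset.prod_mul_distrib, Finset.prod_pow_eq_pow_sum, c.sum_blocksFun]
          simp
    calc ‖P.compAlongComposition q c‖ ≤ ‖P c.length‖ * ∏ i, ‖q (c.blocksFun i)‖ :=
          P.compAlongComposition_norm q c
      _ ≤ (B * a ^ c.length) * (D ^ c.length * b ^ k) := by
        gcongr
        exact hP _
      _ = B * (a * D) ^ c.length * b ^ k := by rw [mul_pow]; ring
      _ ≤ B * max 1 (a * D) ^ k * b ^ k := by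
        gcongr
        calc (a * D) ^ c.length ≤ max 1 (a * D) ^ c.length := by
              gcongr; exact le_max_right _ _
          _ ≤ _ := pow_le_pow_right₀ hm c.length_le
      _ = _ := by rw [mul_pow]; ring
  calc ‖P.comp q k‖ = ‖∑ c : Composition k, P.compAlongComposition q c‖ := rfl
    _ ≤ ∑ c : Composition k, B * (max 1 (a * D) * b) ^ k :=
      norm_sum_le_of_le _ fun c _ => h1 c
    _ = 2 ^ (k - 1) * (B * (max 1 (a * D) * b) ^ k) := by
      rw [Finset.sum_const, Finset.card_univ, composition_card, nsmul_eq_mul]; push_cast; rfl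
    _ ≤ 2 ^ k * (B * (max 1 (a * D) * b) ^ k) := by
      gcongr
      · norm_num
      · omega
    _ = _ := by simp only [mul_pow]; ring

lemma HasFPowerSeriesAt.norm_iteratedFDeriv_le {F : Type*} [NormedAddCommGroup F]
    [NormedSpace ℝ F] [CompleteSpace F] {f : E → F} {p : FormalMultilinearSeries ℝ E F} {x : E}
    (h : HasFPowerSeriesAt f p x) (k : ℕ) :
    ‖iteratedFDeriv ℝ k f x‖ ≤ k.factorial * ‖p k‖ := by
  obtain ⟨r, hr⟩ := h
  refine ContinuousMultilinearMap.opNorm_le_bound (by positivity) fun v => ?_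
  rw [hr.iteratedFDeriv_eq_sum_of_completeSpace]
  calc ‖∑ σ : Equiv.Perm (Fin k), (p k) fun i => v (σ i)‖
      ≤ ∑ σ : Equiv.Perm (Fin k), ‖p k‖ * ∏ i, ‖v i‖ := by
        refine norm_sum_le_of_le _ fun σ _ => ?_
        refine ((p k).le_opNorm _).trans_eq ?_
        rw [Equiv.prod_comp σ fun i => ‖v i‖]
    _ = _ := by
      rw [Finset.sum_const, Finset.card_univ, Fintype.card_perm, Fintype.card_fin, nsmul_eq_mul,
        mul_assoc]

/-- Power series expansions of an analytic function have locally uniform geometric bounds. -/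
lemma AnalyticAt.exists_uniform_bound {F : Type*} [NormedAddCommGroup F]
    [NormedSpace ℝ F] [CompleteSpace F] {f : E → F} {x₀ : E} (hf : AnalyticAt ℝ f x₀) :
    ∃ ε C R : ℝ, 0 < ε ∧ 0 < C ∧ 1 ≤ R ∧ ∀ x ∈ Metric.ball x₀ ε,
      ∃ p : FormalMultilinearSeries ℝ E F, HasFPowerSeriesAt f p x ∧ ∀ k, ‖p k‖ ≤ C * R ^ k := by
  obtain ⟨p, r, hr⟩ := hf
  obtain ⟨ρ, hρ0, hρ⟩ := ENNReal.lt_iff_exists_nnreal_btwn.1 hr.r_pos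
  have hρ0' : (0 : ℝ) < ρ := by exact_mod_cast hρ0
  obtain ⟨C, hC, hbound⟩ := p.norm_mul_pow_le_of_lt_radius (hρ.trans_le hr.r_le)
  set a : ℝ := max 1 (ρ : ℝ)⁻¹ with ha
  have ha1 : 1 ≤ a := le_max_left _ _
  have haρ : (ρ : ℝ)⁻¹ ≤ a := le_max_right _ _
  have hpk : ∀ k, ‖p k‖ ≤ C * a ^ k := fun k => by
    have h1 := hbound k
    rw [← le_div_iff₀ (by positivity)] at h1
    refine h1.trans ?_
    rw [div_eq_mul_inv, ← inv_pow]
    gcongr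
  refine ⟨(4 * a)⁻¹, C * 2, 2 * a, by positivity, by positivity, by linarith, fun x hx => ?_⟩
  set y := x - x₀ with hy
  have hyn : ‖y‖ < (4 * a)⁻¹ := by rwa [mem_ball_iff_norm] at hx
  have hyρ : ‖y‖ < ρ := by
    refine hyn.trans_le ?_
    rw [inv_le_comm₀ (by positivity) hρ0']
    linarith
  have hyr : (‖y‖₊ : ENNReal) < r := by
    refine lt_trans ?_ hρ
    exact_mod_cast hyρ
  refine ⟨p.changeOrigin y, ?_, fun k => ?_⟩
  · have := hr.changeOrigin hyr
    rw [hy, add_sub_cancel] at this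
    exact this.hasFPowerSeriesAt
  · have hrad := hyr.trans_le hr.r_le
    have h1 : ∀ l, ‖p.changeOriginSeries k l‖ * ‖y‖ ^ l ≤ C * (2 * a) ^ k * (1 / 2) ^ l := by
      intro l
      have h2 : ‖p.changeOriginSeries k l‖ ≤ (2 : ℝ) ^ (k + l) * (C * a ^ (k + l)) := by
        have h3 := p.nnnorm_changeOriginSeries_le_tsum k l
        have h4 : (∑' _ : { s : Finset (Fin (k + l)) // s.card = l }, ‖p (k + l)‖₊)
            ≤ 2 ^ (k + l) * ‖p (k + l)‖₊ := by
          rw [tsum_fintype, Finset.sum_const, nsmul_eq_mul]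
          gcongr
          have h5 := Fintype.card_subtype_le
            (fun s : Finset (Fin (k + l)) => s.card = l)
          rw [Fintype.card_finset, Fintype.card_fin] at h5
          exact_mod_cast h5
        have h6 : ‖p.changeOriginSeries k l‖ ≤ 2 ^ (k + l) * ‖p (k + l)‖ := by
          exact_mod_cast h3.trans h4
        refine h6.trans ?_
        gcongr
        exact hpk _
      calc ‖p.changeOriginSeries k l‖ * ‖y‖ ^ l
          ≤ ((2 : ℝ) ^ (k + l) * (C * a ^ (k + l))) * ((4 * a)⁻¹) ^ l := by gcongr
        _ = C * (2 * a) ^ k * (2 * a * (4 * a)⁻¹) ^ l := by simp only [mul_pow, pow_add]; ring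
        _ = _ := by congr 2; field_simp; norm_num
    have hgeo : HasSum (fun l : ℕ => C * (2 * a) ^ k * (1 / 2) ^ l) (C * (2 * a) ^ k * 2) :=
      hasSum_geometric_two.mul_left _
    have h7 : ‖p.changeOrigin y k‖ ≤ C * (2 * a) ^ k * 2 := by
      unfold FormalMultilinearSeries.changeOrigin FormalMultilinearSeries.sum
      refine tsum_of_norm_bounded hgeo fun l => ?_
      refine ((p.changeOriginSeries k l).le_opNorm _).trans ?_
      simpa using h1 l
    linarith

lemma exists_real_power_series_of_differentiableOn {F : ℂ → ℂ} {z : ℂ} {R B : ℝ} (hR : 0 < R)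
    (hF : DifferentiableOn ℂ F (Metric.closedBall z R))
    (hB : ∀ y ∈ Metric.closedBall z R, ‖F y‖ ≤ B) :
    ∃ P : FormalMultilinearSeries ℝ ℂ ℂ, HasFPowerSeriesAt F P z ∧
      ∀ k, ‖P k‖ ≤ B * R⁻¹ ^ k := by
  lift R to NNReal using hR.le
  have h := hF.hasFPowerSeriesOnBall (by exact_mod_cast hR)
  refine ⟨_, (h.restrictScalars (𝕜 := ℝ)).hasFPowerSeriesAt, fun k => ?_⟩
  have e : ‖(cauchyPowerSeries F z R).restrictScalars ℝ k‖ = ‖cauchyPowerSeries F z R k‖ :=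
    ContinuousMultilinearMap.norm_restrictScalars _
  rw [e]
  refine (norm_cauchyPowerSeries_le F z R k).trans ?_
  rw [abs_of_pos hR]
  gcongr
  have h1 : ∫ θ in (0 : ℝ)..2 * Real.pi, ‖F (circleMap z R θ)‖ ≤ B * |2 * Real.pi - 0| := by
    refine (Real.le_norm_self _).trans ?_
    refine intervalIntegral.norm_integral_le_of_norm_le_const fun θ _ => ?_
    rw [norm_norm]
    exact hB _ (Metric.sphere_subset_closedBall (circleMap_mem_sphere z hR.le θ))
  rw [sub_zero, abs_of_pos Real.two_pi_pos] at h1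
  rw [inv_mul_le_iff₀ Real.two_pi_pos]
  linarith

/-- Cauchy-type estimates for a holomorphic function composed with a real-analytic map whose
derivative is small at the point in question. -/
lemma HasFPowerSeriesAt.holomorphic_comp {F : ℂ → ℂ} {q : E → ℂ} {x : E}
    {p : FormalMultilinearSeries ℝ E ℂ} (hq : HasFPowerSeriesAt q p x) {C R t c B : ℝ}
    (hC : 0 ≤ C) (hR : 1 ≤ R) (ht : 0 < t) (ht1 : t ≤ 1) (hc : 0 < c) (hp1 : ‖p 1‖ ≤ C * t)
    (hp : ∀ k, ‖p k‖ ≤ C * R ^ k)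
    (hF : DifferentiableOn ℂ F (Metric.closedBall (q x) (c * t ^ 2)))
    (hB : ∀ y ∈ Metric.closedBall (q x) (c * t ^ 2), ‖F y‖ ≤ B) :
    AnalyticAt ℝ (fun y => F (q y)) x ∧ ∀ k : ℕ, ‖iteratedFDeriv ℝ k (fun y => F (q y)) x‖ ≤
      k.factorial * (B * (2 * max 1 (C / c) * R / t) ^ k) := by
  obtain ⟨P, hP, hPb⟩ := exists_real_power_series_of_differentiableOn (by positivity) hF hB
  have hcomp : HasFPowerSeriesAt (fun y => F (q y)) (P.comp p) x := hP.comp hq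
  have hB0 : 0 ≤ B := (norm_nonneg _).trans (hB _ (Metric.mem_closedBall_self (by positivity)))
  refine ⟨hcomp.analyticAt, fun k => (hcomp.norm_iteratedFDeriv_le k).trans ?_⟩
  gcongr
  have hp' : ∀ k, 1 ≤ k → ‖p k‖ ≤ C * t ^ 2 * (R / t) ^ k := by
    intro k hk
    rcases hk.eq_or_lt with rfl | hk
    · refine hp1.trans ?_
      calc C * t ≤ C * t * R := le_mul_of_one_le_right (by positivity) hR
        _ = _ := by field_simp
    · refine (hp k).trans ?_
      obtain ⟨d, rfl⟩ := Nat.exists_eq_add_of_le (show 2 ≤ k from hk)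
      rw [mul_assoc]
      refine mul_le_mul_of_nonneg_left ?_ hC
      have : t ^ 2 * (R / t) ^ (2 + d) = R ^ (2 + d) / t ^ d := by
        rw [div_pow, pow_add t]; field_simp
      rw [this, le_div_iff₀ (by positivity)]
      exact mul_le_of_le_one_right (by positivity) (pow_le_one₀ ht.le ht1)
  have := P.norm_comp_le p hB0 (by positivity) (by positivity) (by positivity) hPb hp' k
  have e : (c * t ^ 2)⁻¹ * (C * t ^ 2) = C / c := by field_simp
  rw [e] at this
  rwa [mul_div_assoc]

end AnalyticEstimates

section FlatExtension

variable {E : Type*} [NormedAddCommGroup E] [NormedSpace ℝ E]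
  {F : Type*} [NormedAddCommGroup F] [NormedSpace ℝ F]

lemma ContDiffAt.hasFDerivAt_iteratedFDeriv {f : E → F} {x : E}
    (hf : ContDiffAt ℝ (⊤ : ℕ∞) f x) (m : ℕ) :
    HasFDerivAt (iteratedFDeriv ℝ m f) (iteratedFDeriv ℝ (m + 1) f x).curryLeft x := by
  have h1 : DifferentiableAt ℝ (iteratedFDeriv ℝ m f) x :=
    hf.differentiableAt_iteratedFDeriv (by exact_mod_cast WithTop.coe_lt_top m)
  have h2 : fderiv ℝ (iteratedFDeriv ℝ m f) x = (iteratedFDeriv ℝ (m + 1) f x).curryLeft := by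
    rw [fderiv_iteratedFDeriv]; rfl
  exact h2 ▸ h1.hasFDerivAt

/-- A function which is smooth off the zero set of `ρ`, with derivatives that decay
quadratically in `ρ`, is smooth across the zero set and flat on it. -/
lemma contDiffOn_of_flat_bounds {U : Set E} (hU : IsOpen U) {ρ : E → ℝ} (hρc : ContinuousOn ρ U)
    {L : ℝ} (hρ : ∀ x ∈ U, ρ x = 0 → ∀ y ∈ U, |ρ y| ≤ L * ‖y - x‖) {f : E → F}
    (hf : ∀ x ∈ U, ρ x ≠ 0 → ContDiffAt ℝ (⊤ : ℕ∞) f x) (hf0 : ∀ x ∈ U, ρ x = 0 → f x = 0)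
    (hbd : ∀ k : ℕ, ∃ C, 0 ≤ C ∧ ∀ x ∈ U, ρ x ≠ 0 → ‖iteratedFDeriv ℝ k f x‖ ≤ C * ρ x ^ 2) :
    ContDiffOn ℝ (⊤ : ℕ∞) f U ∧ ∀ x ∈ U, ρ x = 0 → ∀ k, iteratedFDeriv ℝ k f x = 0 := by
  classical
  set p : E → FormalMultilinearSeries ℝ E F :=
    fun x k => if ρ x = 0 then 0 else iteratedFDeriv ℝ k f x with hp
  have hder : ∀ m : ℕ, ∀ x ∈ U, HasFDerivWithinAt (fun x => p x m) (p x m.succ).curryLeft U x := by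
    intro m x hx
    by_cases h0 : ρ x = 0
    · have e : (p x m.succ).curryLeft = 0 := by
        have : p x m.succ = 0 := if_pos h0
        rw [this]; rfl
      rw [e]
      obtain ⟨C, hC0, hC⟩ := hbd m
      refine Asymptotics.IsBigO.hasFDerivWithinAt (n := 2) ?_ hx (by norm_num)
      refine Asymptotics.IsBigO.of_bound (C * L ^ 2) ?_
      filter_upwards [self_mem_nhdsWithin] with y hy
      rw [norm_pow, norm_norm]
      by_cases hy0 : ρ y = 0
      · have : p y m = 0 := if_pos hy0
        rw [this, norm_zero]; positivity
      · have : p y m = iteratedFDeriv ℝ m f y := if_neg hy0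
        rw [this]
        refine (hC y hy hy0).trans ?_
        have h1 : ρ y ^ 2 ≤ (L * ‖y - x‖) ^ 2 := sq_le_sq' (by linarith [abs_le.1 (hρ x hx h0 y hy)])
          (abs_le.1 (hρ x hx h0 y hy)).2
        calc C * ρ y ^ 2 ≤ C * (L * ‖y - x‖) ^ 2 := by gcongr
          _ = _ := by ring
    · have e : p x m.succ = iteratedFDeriv ℝ (m + 1) f x := if_neg h0
      rw [e]
      refine HasFDerivAt.hasFDerivWithinAt ?_
      refine ((hf x hx h0).hasFDerivAt_iteratedFDeriv m).congr_of_eventuallyEq ?_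
      filter_upwards [(hρc.continuousAt (hU.mem_nhds hx)).eventually_ne h0] with y hy
      exact if_neg hy
  have hT : HasFTaylorSeriesUpToOn (⊤ : ℕ∞) f p U := by
    refine ⟨fun x hx => ?_, fun m _ => hder m, fun m _ x hx => (hder m x hx).continuousWithinAt⟩
    by_cases h0 : ρ x = 0
    · have : p x 0 = 0 := if_pos h0
      rw [this, hf0 x hx h0]; rfl
    · have : p x 0 = iteratedFDeriv ℝ 0 f x := if_neg h0
      rw [this]; rfl
  refine ⟨hT.contDiffOn, fun x hx h0 k => ?_⟩
  rw [← iteratedFDerivWithin_of_isOpen k hU hx,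
    ← hT.eq_iteratedFDerivWithin_of_uniqueDiffOn (by exact_mod_cast le_top) hU.uniqueDiffOn hx]
  exact if_pos h0

/-- Taylor estimate on a segment starting at a point of flatness. -/
lemma norm_iteratedFDeriv_le_of_flat {f : E → F} {x y : E}
    (hf : ∀ s ∈ Set.Icc (0 : ℝ) 1, ContDiffAt ℝ (⊤ : ℕ∞) f (x + s • (y - x)))
    (h0 : ∀ k, iteratedFDeriv ℝ k f x = 0) {B : ℕ → ℝ}
    (hB : ∀ k, ∀ s ∈ Set.Icc (0 : ℝ) 1, ‖iteratedFDeriv ℝ k f (x + s • (y - x))‖ ≤ B k)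
    (j i : ℕ) : ‖iteratedFDeriv ℝ j f y‖ ≤ B (j + i) * (‖y - x‖ ^ i / i.factorial) := by
  suffices H : ∀ i j : ℕ, ∀ s ∈ Set.Icc (0 : ℝ) 1,
      ‖iteratedFDeriv ℝ j f (x + s • (y - x))‖ ≤
        B (j + i) * (‖y - x‖ ^ i / i.factorial) * s ^ i by
    simpa using H i j 1 (by simp)
  intro i
  induction i with
  | zero => intro j s hs; simpa using hB j s hs
  | succ i ih =>
    intro j
    have hline : ∀ s : ℝ, HasDerivAt (fun s : ℝ => x + s • (y - x)) (y - x) s := fun s => by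
      simpa using ((hasDerivAt_id s).smul_const (y - x)).const_add x
    have hd : ∀ s ∈ Set.Icc (0 : ℝ) 1,
        HasDerivAt (fun s : ℝ => iteratedFDeriv ℝ j f (x + s • (y - x)))
          ((iteratedFDeriv ℝ (j + 1) f (x + s • (y - x))).curryLeft (y - x)) s := fun s hs =>
      ((hf s hs).hasFDerivAt_iteratedFDeriv j).comp_hasDerivAt s (hline s)
    refine image_norm_le_of_norm_deriv_right_le_deriv_boundary
      (fun s hs => (hd s hs).continuousAt.continuousWithinAt)
      (fun s hs => (hd s (Set.Ico_subset_Icc_self hs)).hasDerivWithinAt)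
      (B' := fun s => B (j + (i + 1)) * (‖y - x‖ ^ (i + 1) / i.factorial) * s ^ i)
      (by simp [h0]) (fun s => ?_) (fun s hs => ?_)
    · have h1 := (hasDerivAt_pow (i + 1) s).const_mul
        (B (j + (i + 1)) * (‖y - x‖ ^ (i + 1) / (i + 1).factorial))
      refine h1.congr_deriv ?_
      rw [Nat.factorial_succ]
      push_cast
      field_simp
    · have h2 := ih (j + 1) s (Set.Ico_subset_Icc_self hs)
      calc ‖(iteratedFDeriv ℝ (j + 1) f (x + s • (y - x))).curryLeft (y - x)‖
          ≤ ‖(iteratedFDeriv ℝ (j + 1) f (x + s • (y - x))).curryLeft‖ * ‖y - x‖ :=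
            ContinuousLinearMap.le_opNorm _ _
        _ = ‖iteratedFDeriv ℝ (j + 1) f (x + s • (y - x))‖ * ‖y - x‖ := by
            rw [ContinuousMultilinearMap.curryLeft_norm]
        _ ≤ (B (j + 1 + i) * (‖y - x‖ ^ i / i.factorial) * s ^ i) * ‖y - x‖ := by gcongr
        _ = _ := by rw [add_assoc, add_comm 1 i]; ring

end FlatExtension

section ClassCM

variable {n : ℕ}

lemma norm_le_of_norm_apply_single_le {k : ℕ}
    (T : ContinuousMultilinearMap ℝ (fun _ : Fin k => EuclideanSpace ℝ (Fin n)) ℂ) {B : ℝ}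
    (hB : 0 ≤ B)
    (h : ∀ e : Fin k → Fin n, ‖T fun i => EuclideanSpace.single (e i) 1‖ ≤ B) :
    ‖T‖ ≤ n ^ k * B := by
  refine ContinuousMultilinearMap.opNorm_le_bound (by positivity) fun v => ?_
  have hv : v = fun i => ∑ j, v i j • EuclideanSpace.single j (1 : ℝ) := by
    funext i
    have := (EuclideanSpace.basisFun (Fin n) ℝ).sum_repr (v i)
    simpa using this.symm
  have e : T v = ∑ e : Fin k → Fin n,
      (∏ i, v i (e i)) • T fun i => EuclideanSpace.single (e i) 1 := by
    conv_lhs => rw [hv]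
    rw [T.map_sum]
    exact Finset.sum_congr rfl fun e _ => T.map_smul_univ _ _
  rw [e]
  calc ‖∑ e : Fin k → Fin n, (∏ i, v i (e i)) • T fun i => EuclideanSpace.single (e i) 1‖
      ≤ ∑ e : Fin k → Fin n, (∏ i, ‖v i‖) * B := by
        refine norm_sum_le_of_le _ fun e _ => ?_
        rw [norm_smul, norm_prod]
        gcongr with i
        · exact PiLp.norm_apply_le (v i) (e i)
        · exact h e
    _ = _ := by
      rw [Finset.sum_const, Finset.card_univ, Fintype.card_fun, Fintype.card_fin,
        Fintype.card_fin, nsmul_eq_mul]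
      push_cast; ring

lemma mixedPartial_eq {S : Set (EuclideanSpace ℝ (Fin n))} (hS : IsOpen S)
    (f : EuclideanSpace ℝ (Fin n) → ℂ) (k : ℕ) (e : Fin k → Fin n)
    {x : EuclideanSpace ℝ (Fin n)} (hx : x ∈ S) :
    mixedPartial S f k e x = iteratedFDeriv ℝ k f x fun i => EuclideanSpace.single (e i) 1 := by
  rw [mixedPartial, iteratedFDerivWithin_of_isOpen k hS hx]

lemma ClassCMOn.exists_norm_iteratedFDeriv_le {M : ℕ → ℝ} (hM : ∀ j, 0 < M j)
    {S : Set (EuclideanSpace ℝ (Fin n))} (hS : IsOpen S) {f : EuclideanSpace ℝ (Fin n) → ℂ}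
    (hf : ClassCMOn M S f) :
    ∃ C σ : ℝ, 0 < C ∧ 0 < σ ∧ ∀ k, ∀ x ∈ S,
      ‖iteratedFDeriv ℝ k f x‖ ≤ C * σ ^ k * k.factorial * M k := by
  obtain ⟨-, C, σ, hC, hσ, h⟩ := hf
  refine ⟨C, (n + 1) * σ, hC, by positivity, fun k x hx => ?_⟩
  have hMk := hM k
  have h1 : ‖iteratedFDeriv ℝ k f x‖ ≤ n ^ k * (C * σ ^ k * k.factorial * M k) := by
    refine norm_le_of_norm_apply_single_le _ (by positivity) fun e => ?_
    rw [← mixedPartial_eq hS f k e hx]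
    exact h k e x hx
  refine h1.trans ?_
  calc (n : ℝ) ^ k * (C * σ ^ k * k.factorial * M k)
      ≤ ((n : ℝ) + 1) ^ k * (C * σ ^ k * k.factorial * M k) := by gcongr; linarith
    _ = _ := by rw [mul_pow]; ring

lemma classCMOn_of_norm_iteratedFDeriv_le {M : ℕ → ℝ}
    {S : Set (EuclideanSpace ℝ (Fin n))} (hS : IsOpen S) {f : EuclideanSpace ℝ (Fin n) → ℂ}
    (hf : ContDiffOn ℝ (⊤ : ℕ∞) f S) {C σ : ℝ} (hC : 0 < C) (hσ : 0 < σ)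
    (h : ∀ k, ∀ x ∈ S, ‖iteratedFDeriv ℝ k f x‖ ≤ C * σ ^ k * k.factorial * M k) :
    ClassCMOn M S f := by
  refine ⟨hf, C, σ, hC, hσ, fun k e x hx => ?_⟩
  rw [mixedPartial_eq hS f k e hx]
  refine ((iteratedFDeriv ℝ k f x).le_opNorm _).trans ?_
  simpa using h k x hx

lemma FlatOn.iteratedFDeriv_eq_zero {S X : Set (EuclideanSpace ℝ (Fin n))} (hS : IsOpen S)
    {f : EuclideanSpace ℝ (Fin n) → ℂ} (hf : FlatOn S X f) {x : EuclideanSpace ℝ (Fin n)}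
    (hxX : x ∈ X) (hxS : x ∈ S) (k : ℕ) : iteratedFDeriv ℝ k f x = 0 := by
  have := norm_le_of_norm_apply_single_le (iteratedFDeriv ℝ k f x) le_rfl fun e => by
    rw [← mixedPartial_eq hS f k e hxS, hf x hxX k e, norm_zero]
  rwa [mul_zero, norm_le_zero_iff] at this

/-- Bounds `‖D^k f‖ ≤ C σ^k k! M_k ρ^2` off the zero set of `ρ` put `f` in the class and make it
flat on that zero set. -/
lemma classCMOn_and_flatOn_of_bounds {M : ℕ → ℝ} (hM : ∀ j, 0 < M j)
    {U X : Set (EuclideanSpace ℝ (Fin n))} (hU : IsOpen U)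
    {ρ : EuclideanSpace ℝ (Fin n) → ℝ} (hρc : ContinuousOn ρ U)
    {L : ℝ} (hρ : ∀ x ∈ U, ρ x = 0 → ∀ y ∈ U, |ρ y| ≤ L * ‖y - x‖)
    (hρ1 : ∀ x ∈ U, |ρ x| ≤ 1) (hX : ∀ x ∈ X, x ∈ U ∧ ρ x = 0)
    {f : EuclideanSpace ℝ (Fin n) → ℂ}
    (hf : ∀ x ∈ U, ρ x ≠ 0 → ContDiffAt ℝ (⊤ : ℕ∞) f x) (hf0 : ∀ x ∈ U, ρ x = 0 → f x = 0)
    {C σ : ℝ} (hC : 0 < C) (hσ : 0 < σ)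
    (hbd : ∀ k : ℕ, ∀ x ∈ U, ρ x ≠ 0 →
      ‖iteratedFDeriv ℝ k f x‖ ≤ C * σ ^ k * k.factorial * M k * ρ x ^ 2) :
    ClassCMOn M U f ∧ FlatOn U X f := by
  obtain ⟨h1, h2⟩ := contDiffOn_of_flat_bounds hU hρc hρ hf hf0
    fun k => ⟨C * σ ^ k * k.factorial * M k, by have := hM k; positivity, hbd k⟩
  refine ⟨classCMOn_of_norm_iteratedFDeriv_le hU h1 hC hσ fun k x hx => ?_, fun x hx k e => ?_⟩
  · have := hM k
    by_cases h0 : ρ x = 0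
    · rw [h2 x hx h0 k, norm_zero]; positivity
    · refine (hbd k x hx h0).trans (mul_le_of_le_one_right (by positivity) ?_)
      rw [← sq_abs]
      exact pow_le_one₀ (abs_nonneg _) (hρ1 x hx)
  · obtain ⟨hxU, hx0⟩ := hX x hx
    rw [mixedPartial_eq hU f k e hxU, h2 x hxU hx0 k]
    rfl

end ClassCM

section LocalGeometry

variable {n : ℕ}

/-- The complexified square of the norm of `y`. -/
def normSqC (y : EuclideanSpace ℝ (Fin n) → EuclideanSpace ℝ (Fin n))
    (x : EuclideanSpace ℝ (Fin n)) : ℂ := (‖y x‖ : ℂ) ^ 2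

lemma AnalyticAt.normSqC {y : EuclideanSpace ℝ (Fin n) → EuclideanSpace ℝ (Fin n)}
    {x : EuclideanSpace ℝ (Fin n)} (hy : AnalyticAt ℝ y x) : AnalyticAt ℝ (normSqC y) x := by
  have h1 : AnalyticAt ℝ (fun z : EuclideanSpace ℝ (Fin n) => ‖z‖ ^ 2) (y x) :=
    (contDiff_norm_sq ℝ).contDiffAt.analyticAt
  have h2 : AnalyticAt ℝ (fun z => Complex.ofRealCLM (‖y z‖ ^ 2)) x :=
    (Complex.ofRealCLM.analyticAt _).fun_comp (h1.fun_comp hy)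
  refine h2.congr (Eventually.of_forall fun z => ?_)
  simp [_root_.normSqC]

lemma norm_fderiv_normSqC_le {y : EuclideanSpace ℝ (Fin n) → EuclideanSpace ℝ (Fin n)}
    {x : EuclideanSpace ℝ (Fin n)} (hy : DifferentiableAt ℝ y x) {f' : EuclideanSpace ℝ (Fin n) →L[ℝ] ℂ}
    (hf' : HasFDerivAt (normSqC y) f' x) : ‖f'‖ ≤ 2 * ‖fderiv ℝ y x‖ * ‖y x‖ := by
  have h1 := Complex.ofRealCLM.hasFDerivAt.comp x hy.hasFDerivAt.norm_sq
  have e : Complex.ofRealCLM ∘ (fun z => ‖y z‖ ^ 2) = normSqC y := by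
    funext z; simp [normSqC]
  rw [e] at h1
  rw [hf'.unique h1]
  refine ContinuousLinearMap.opNorm_le_bound _ (by positivity) fun v => ?_
  simp only [ContinuousLinearMap.comp_apply, Complex.ofRealCLM_apply, Complex.norm_real,
    smul_apply, innerSL_apply_apply]
  rw [nsmul_eq_mul, norm_mul]
  have h2 := norm_inner_le_norm (𝕜 := ℝ) (y x) (fderiv ℝ y x v)
  have h3 := (fderiv ℝ y x).le_opNorm v
  calc ‖((2 : ℕ) : ℝ)‖ * ‖inner ℝ (y x) (fderiv ℝ y x v)‖
      ≤ 2 * (‖y x‖ * (‖fderiv ℝ y x‖ * ‖v‖)) := by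
        have : ‖((2 : ℕ) : ℝ)‖ = 2 := by norm_num
        rw [this]
        gcongr
        exact h2.trans (by gcongr)
    _ = _ := by ring

/-- Local analytic equations `y = 0` of an analytic submanifold, whose norm is comparable to the
distance to the submanifold. -/
lemma IsAnalyticSubmanifold.exists_equation {X : Set (EuclideanSpace ℝ (Fin n))}
    (hX : IsAnalyticSubmanifold X) {x₀ : EuclideanSpace ℝ (Fin n)} (hx₀ : x₀ ∈ X) {ε' : ℝ}
    (hε' : 0 < ε') :
    ∃ (y : EuclideanSpace ℝ (Fin n) → EuclideanSpace ℝ (Fin n)) (ε L C R : ℝ),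
      0 < ε ∧ 0 < L ∧ 0 < C ∧ 1 ≤ R ∧
      (∀ x ∈ Metric.ball x₀ ε, ∀ x' ∈ Metric.ball x₀ ε, ‖y x - y x'‖ ≤ L * ‖x - x'‖) ∧
      ∀ x ∈ Metric.ball x₀ ε, (y x = 0 ↔ x ∈ X) ∧ ‖y x‖ ≤ 1 ∧
        (∃ x' ∈ X, x' ∈ Metric.ball x₀ ε' ∧ ‖x - x'‖ ≤ L * ‖y x‖) ∧
        ∃ p : FormalMultilinearSeries ℝ (EuclideanSpace ℝ (Fin n)) ℂ,
          HasFPowerSeriesAt (normSqC y) p x ∧ ‖p 1‖ ≤ C * ‖y x‖ ∧ ∀ k, ‖p k‖ ≤ C * R ^ k := by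
  obtain ⟨U, W, φ, ψ, V, hU, hxU, hW, hφ, hψ, hφm, hψm, hψφ, hφψ, him⟩ := hX x₀ hx₀
  set π := V.starProjection
  have hπ : ∀ z, π z = z ↔ z ∈ V := fun z => Submodule.starProjection_eq_self_iff
  have hmem : ∀ x ∈ U, (φ x ∈ V ↔ x ∈ X) := by
    intro x hx
    constructor
    · intro h
      have : φ x ∈ φ '' (X ∩ U) := by rw [him]; exact ⟨h, hφm hx⟩
      obtain ⟨x', ⟨hx'X, hx'U⟩, he⟩ := this
      rw [← hψφ x hx, ← he, hψφ x' hx'U]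
      exact hx'X
    · intro h
      have : φ x ∈ (V : Set (EuclideanSpace ℝ (Fin n))) ∩ W := by
        rw [← him]; exact ⟨x, ⟨h, hx⟩, rfl⟩
      exact this.1
  set y : EuclideanSpace ℝ (Fin n) → EuclideanSpace ℝ (Fin n) := fun x => φ x - π (φ x) with hy
  have hya : ∀ x ∈ U, AnalyticAt ℝ y x := fun x hx =>
    (hφ x hx).sub ((π.analyticAt _).comp (hφ x hx))
  have hφ0 : π (φ x₀) = φ x₀ := (hπ _).2 ((hmem x₀ hxU).2 hx₀)
  have hy0 : y x₀ = 0 := by simp [hy, hφ0]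
  have hyc : ContinuousAt y x₀ := (hya x₀ hxU).continuousAt
  have hφc : ContinuousAt φ x₀ := (hφ x₀ hxU).continuousAt
  have hπφc : ContinuousAt (fun x => π (φ x)) x₀ := π.continuous.continuousAt.comp hφc
  have hφW : φ x₀ ∈ W := hφm hxU
  obtain ⟨K₁, T₁, hT₁, hlip₁⟩ :=
    ((hya x₀ hxU).contDiffAt (n := 1)).exists_lipschitzOnWith
  obtain ⟨K₂, T₂, hT₂, hlip₂⟩ :=
    ((hψ (φ x₀) hφW).contDiffAt (n := 1)).exists_lipschitzOnWith
  obtain ⟨ε₁, C, R, hε₁, hC, hR, hser⟩ := (hya x₀ hxU).normSqC.exists_uniform_bound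
  have hψc : ContinuousAt (fun x => ψ (π (φ x))) x₀ :=
    ContinuousAt.comp (g := ψ) (by rw [hφ0]; exact (hψ _ hφW).continuousAt) hπφc
  have hψ0 : ψ (π (φ x₀)) = x₀ := by rw [hφ0, hψφ _ hxU]
  have hev : ∀ᶠ x in 𝓝 x₀, x ∈ U ∧ x ∈ T₁ ∧ φ x ∈ T₂ ∧ π (φ x) ∈ T₂ ∧ π (φ x) ∈ W ∧
      ‖y x‖ < 1 ∧ ψ (π (φ x)) ∈ Metric.ball x₀ ε' ∧ x ∈ Metric.ball x₀ ε₁ := by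
    filter_upwards [hU.mem_nhds hxU, hT₁, hφc.eventually_mem hT₂,
      hπφc.eventually_mem (by rwa [hφ0]), hπφc.eventually_mem (by rw [hφ0]; exact hW.mem_nhds hφW),
      hyc.norm.eventually_lt_const (show ‖y x₀‖ < 1 by rw [hy0, norm_zero]; exact one_pos),
      hψc.eventually_mem (by rw [hψ0]; exact Metric.ball_mem_nhds x₀ hε'),
      Metric.ball_mem_nhds x₀ hε₁] with x h1 h2 h3 h4 h5 h6 h7 h8
    exact ⟨h1, h2, h3, h4, h5, h6, h7, h8⟩
  obtain ⟨ε, hε, hball⟩ := Metric.eventually_nhds_iff_ball.1 hev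
  refine ⟨y, ε, K₁ + K₂ + 1, max C (2 * K₁), R, hε, by positivity, by positivity, hR,
    fun x hx x' hx' => ?_, fun x hx => ?_⟩
  · refine (hlip₁.norm_sub_le (hball x hx).2.1 (hball x' hx').2.1).trans ?_
    gcongr
    linarith [K₂.coe_nonneg]
  obtain ⟨h1, h2, h3, h4, h5, h6, h7, h8⟩ := hball x hx
  refine ⟨?_, h6.le, ⟨ψ (π (φ x)), ?_, h7, ?_⟩, ?_⟩
  · rw [← hmem x h1, ← hπ, hy, sub_eq_zero, eq_comm]
  · rw [← hmem _ (hψm h5), hφψ _ h5]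
    exact V.starProjection_apply_mem _
  · have h9 := hlip₂.norm_sub_le h3 h4
    rw [hψφ x h1] at h9
    refine h9.trans ?_
    gcongr
    linarith [K₁.coe_nonneg]
  · obtain ⟨p, hp, hpb⟩ := hser x h8
    refine ⟨p, hp, ?_, fun k => (hpb k).trans ?_⟩
    · have h9 := norm_fderiv_normSqC_le (hya x h1).differentiableAt
        hp.hasStrictFDerivAt.hasFDerivAt
      rw [LinearIsometryEquiv.norm_map] at h9
      have hnear : T₁ ∈ 𝓝 x := by
        filter_upwards [Metric.isOpen_ball.mem_nhds hx] with z hz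
        exact (hball z hz).2.1
      have h10 := norm_fderiv_le_of_lipschitzOn ℝ hnear hlip₁
      refine h9.trans ?_
      gcongr
      exact le_trans (by gcongr) (le_max_right _ _)
    · gcongr
      exact le_max_left _ _

end LocalGeometry

section Factorization

variable {E : Type*} [NormedAddCommGroup E] [NormedSpace ℝ E]

lemma norm_iteratedFDeriv_mul_le_of_bounds {M : ℕ → ℝ} {S : Set E} (hS : IsOpen S) {f g : E → ℂ}
    (hf : ContDiffOn ℝ (⊤ : ℕ∞) f S) (hg : ContDiffOn ℝ (⊤ : ℕ∞) g S) {x : E} (hx : x ∈ S)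
    {D s : ℝ} (hD : 0 ≤ D) (hs : 0 ≤ s) (hM : ∀ j, 0 < M j)
    (h : ∀ j l : ℕ, ‖iteratedFDeriv ℝ j f x‖ * ‖iteratedFDeriv ℝ l g x‖ ≤
      D * s ^ (j + l) * (j.factorial * l.factorial) * M (j + l)) (k : ℕ) :
    ‖iteratedFDeriv ℝ k (fun y => f y * g y) x‖ ≤ D * (2 * s) ^ k * k.factorial * M k := by
  have hMk := hM k
  have h1 := norm_iteratedFDerivWithin_mul_le hf hg hS.uniqueDiffOn hx
    (n := k) (by exact_mod_cast le_top)
  simp only [iteratedFDerivWithin_of_isOpen _ hS hx] at h1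
  refine h1.trans ?_
  calc ∑ i ∈ Finset.range (k + 1),
        (k.choose i : ℝ) * ‖iteratedFDeriv ℝ i f x‖ * ‖iteratedFDeriv ℝ (k - i) g x‖
      ≤ ∑ i ∈ Finset.range (k + 1), D * s ^ k * k.factorial * M k := by
        refine Finset.sum_le_sum fun i hi => ?_
        have hik : i ≤ k := by have := Finset.mem_range.1 hi; omega
        have h2 := h i (k - i)
        rw [Nat.add_sub_cancel' hik] at h2
        have h3 : (k.choose i : ℝ) * (i.factorial * (k - i).factorial) = k.factorial := by
          rw [← mul_assoc]; exact_mod_cast Nat.choose_mul_factorial_mul_factorial hik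
        calc (k.choose i : ℝ) * ‖iteratedFDeriv ℝ i f x‖ * ‖iteratedFDeriv ℝ (k - i) g x‖
            = k.choose i * (‖iteratedFDeriv ℝ i f x‖ * ‖iteratedFDeriv ℝ (k - i) g x‖) := by ring
          _ ≤ k.choose i * (D * s ^ k * (i.factorial * (k - i).factorial) * M k) := by gcongr
          _ = D * s ^ k * (k.choose i * (i.factorial * (k - i).factorial)) * M k := by ring
          _ = _ := by rw [h3]
    _ = (k + 1 : ℕ) * (D * s ^ k * k.factorial * M k) := by
      rw [Finset.sum_const, Finset.card_range, nsmul_eq_mul]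
    _ ≤ 2 ^ k * (D * s ^ k * k.factorial * M k) := by
      gcongr
      exact_mod_cast Nat.lt_two_pow_self (n := k)
    _ = _ := by rw [mul_pow]; ring

/-- Near a point of flatness, derivatives of an element of the class are small compared with all
`(τ t) ^ i * M i`. -/
lemma StronglyRegularWith.norm_iteratedFDeriv_le_of_flat {M : ℕ → ℝ} {A : ℝ}
    (hM : StronglyRegularWith M A) {u : E → ℂ} {x y : E} {C σ L t : ℝ} (hC : 0 < C) (hσ : 0 < σ)
    (hL : 0 < L) (ht : 0 < t) (hxy : ‖y - x‖ ≤ L * t)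
    (hu : ∀ s ∈ Set.Icc (0 : ℝ) 1, ContDiffAt ℝ (⊤ : ℕ∞) u (x + s • (y - x)))
    (h0 : ∀ k, iteratedFDeriv ℝ k u x = 0)
    (hB : ∀ k, ∀ s ∈ Set.Icc (0 : ℝ) 1,
      ‖iteratedFDeriv ℝ k u (x + s • (y - x))‖ ≤ C * σ ^ k * k.factorial * M k) (j i : ℕ) :
    ‖iteratedFDeriv ℝ j u y‖ / (C * (2 * A * σ) ^ j * j.factorial * M j) ≤
      (2 * A * σ * L * t) ^ i * M i := by
  have hA := hM.2.2.2.2.1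
  have hMj := hM.1 j
  have hMi := hM.1 i
  have hMji := hM.1 (j + i)
  rw [div_le_iff₀ (by positivity)]
  have hfac : ((j + i).factorial : ℝ) ≤ 2 ^ (j + i) * (j.factorial * i.factorial) := by
    have h1 : (j + i).choose j * j.factorial * i.factorial = (j + i).factorial := by
      simpa using Nat.choose_mul_factorial_mul_factorial (Nat.le_add_right j i)
    have h2 : (j + i).choose j ≤ 2 ^ (j + i) := Nat.choose_le_two_pow _ _
    rw [← h1]
    push_cast
    rw [mul_assoc]
    gcongr
    exact_mod_cast h2
  calc ‖iteratedFDeriv ℝ j u y‖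
      ≤ C * σ ^ (j + i) * (j + i).factorial * M (j + i) * (‖y - x‖ ^ i / i.factorial) :=
        _root_.norm_iteratedFDeriv_le_of_flat hu h0 hB j i
    _ ≤ C * σ ^ (j + i) * (2 ^ (j + i) * (j.factorial * i.factorial)) *
          (A ^ (j + i) * (M j * M i)) * ((L * t) ^ i / i.factorial) := by
        gcongr
        exact hM.2.2.2.2.2.1 j i
    _ = _ := by
        simp only [mul_pow, pow_add]
        field_simp

end Factorization

/-- On an open set, a function equal to `g` off the zeros of a continuous `y` has the same
derivatives as `g` there. -/
lemma eventuallyEq_ite_of_ne_zero {E F G : Type*} [TopologicalSpace E] [TopologicalSpace F]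
    [T1Space F] [Zero F] [Zero G] {y : E → F} {U : Set E} [∀ x, Decidable (y x = 0)]
    (hU : IsOpen U) (hy : ContinuousOn y U) (g : E → G) {x : E} (hx : x ∈ U) (h : y x ≠ 0) :
    (fun z => if y z = 0 then 0 else g z) =ᶠ[𝓝 x] g := by
  have := (hy.continuousAt (hU.mem_nhds hx)).eventually_ne h
  filter_upwards [this] with z hz
  simp [hz]

/-- every `C_M` germ flat on a real-analytic submanifold `X ∋ 0` is a
product of two `C_M` germs flat on `X`, i.e. `m^∞_{X,M} = m^∞_{X,M} ⬝ m^∞_{X,M}`. -/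
theorem stmt19 {n : ℕ} (hn : 1 ≤ n) (M : ℕ → ℝ) (hM : StronglyRegular M)
    (Ω : Set (EuclideanSpace ℝ (Fin n))) (hΩ : IsOpen Ω)
    (h0Ω : (0 : EuclideanSpace ℝ (Fin n)) ∈ Ω)
    (X : Set (EuclideanSpace ℝ (Fin n))) (hXΩ : X ⊆ Ω)
    (hX0 : (0 : EuclideanSpace ℝ (Fin n)) ∈ X)
    (hX : IsAnalyticSubmanifold X)
    (u : EuclideanSpace ℝ (Fin n) → ℂ)
    (hu : ClassCMOn M Ω u) (huflat : FlatOn Ω X u) :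
    ∃ U : Set (EuclideanSpace ℝ (Fin n)), IsOpen U ∧
      (0 : EuclideanSpace ℝ (Fin n)) ∈ U ∧ U ⊆ Ω ∧
      ∃ v w : EuclideanSpace ℝ (Fin n) → ℂ,
        ClassCMOn M U v ∧ FlatOn U (X ∩ U) v ∧
        ClassCMOn M U w ∧ FlatOn U (X ∩ U) w ∧
        ∀ x ∈ U, u x = v x * w x := by
  classical
  obtain ⟨A, hA⟩ := hM
  have hM0 := hA.1
  have hA1 := hA.2.2.2.2.1
  obtain ⟨Cu, σ, hCu, hσ, hub⟩ := hu.exists_norm_iteratedFDeriv_le hM0 hΩ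
  obtain ⟨ε', hε', hballΩ⟩ := Metric.isOpen_iff.1 hΩ 0 h0Ω
  obtain ⟨y, ε, L, C, R, hε, hL, hC, hR, hlip, hy⟩ := hX.exists_equation hX0 hε'
  obtain ⟨c, hc, -, hweight⟩ := hA.exists_flat_weight
  obtain ⟨F, κ, CF, hκ, hCF, hF0, hF⟩ := hweight (2 * A * σ * L) (by positivity)
  set U := Metric.ball (0 : EuclideanSpace ℝ (Fin n)) (min ε ε') with hUdef
  have hU : IsOpen U := Metric.isOpen_ball
  have hUε : U ⊆ Metric.ball 0 ε := Metric.ball_subset_ball (min_le_left _ _)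
  have hUε' : U ⊆ Metric.ball 0 ε' := Metric.ball_subset_ball (min_le_right _ _)
  have hUΩ : U ⊆ Ω := hUε'.trans hballΩ
  have hyc : ContinuousOn y U := by
    refine (LipschitzOnWith.of_dist_le_mul (K := L.toNNReal) fun x hx z hz => ?_).continuousOn
    rw [dist_eq_norm, dist_eq_norm, Real.coe_toNNReal _ hL.le]
    exact hlip x (hUε hx) z (hUε hz)
  have hρ : ∀ x ∈ U, ‖y x‖ = 0 → ∀ z ∈ U, |‖y z‖| ≤ L * ‖z - x‖ := by
    intro x hx h z hz
    have := hlip z (hUε hz) x (hUε hx)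
    rwa [norm_eq_zero.1 h, sub_zero, ← abs_norm] at this
  have hρ1 : ∀ x ∈ U, |‖y x‖| ≤ 1 := fun x hx => by
    rw [abs_norm]; exact (hy x (hUε hx)).2.1
  have hXU : ∀ x ∈ X ∩ U, x ∈ U ∧ ‖y x‖ = 0 := fun x hx =>
    ⟨hx.2, norm_eq_zero.2 ((hy x (hUε hx.2)).1.2 hx.1)⟩
  set σ' := 2 * max 1 (C / c) * R with hσ'
  have hσ'0 : 0 < σ' := by positivity
  have hcomp : ∀ x ∈ U, y x ≠ 0 → ∀ (G : ℂ → ℂ) (B : ℝ),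
      DifferentiableOn ℂ G (Metric.closedBall ((‖y x‖ : ℂ) ^ 2) (c * ‖y x‖ ^ 2)) →
      (∀ z ∈ Metric.closedBall ((‖y x‖ : ℂ) ^ 2) (c * ‖y x‖ ^ 2), ‖G z‖ ≤ B) →
      AnalyticAt ℝ (fun z => G (normSqC y z)) x ∧
      ∀ k : ℕ, ‖iteratedFDeriv ℝ k (fun z => G (normSqC y z)) x‖ ≤
        k.factorial * (B * (σ' / ‖y x‖) ^ k) := by
    intro x hx hx0 G B hG hB
    obtain ⟨-, h1, -, p, hp, hp1, hpk⟩ := hy x (hUε hx)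
    exact hp.holomorphic_comp hC.le hR (norm_pos_iff.2 hx0) h1 hc hp1 hpk hG hB
  have hwbd : ∀ x ∈ U, y x ≠ 0 → ∀ k : ℕ,
      ‖iteratedFDeriv ℝ k (fun z => F (normSqC y z)) x‖ ≤
        CF * (κ * σ') ^ k * k.factorial * M k * ‖y x‖ ^ 2 := by
    intro x hx hx0 k
    have ht := norm_pos_iff.2 hx0
    obtain ⟨hd, hb⟩ := hF ‖y x‖ ht
    refine ((hcomp x hx hx0 F _ hd fun z hz => (hb z hz).1 k).2 k).trans_eq ?_
    rw [mul_pow, mul_pow, div_pow]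
    field_simp
  have hinv : ∀ x ∈ U, y x ≠ 0 →
      DifferentiableOn ℂ (fun z => (F z)⁻¹)
        (Metric.closedBall ((‖y x‖ : ℂ) ^ 2) (c * ‖y x‖ ^ 2)) := fun x hx hx0 =>
    (hF ‖y x‖ (norm_pos_iff.2 hx0)).1.fun_inv fun z _ => hF0 z
  have hinvbd : ∀ x ∈ U, y x ≠ 0 → ∀ a : ℝ, 0 ≤ a →
      (∀ i, a ≤ (2 * A * σ * L * ‖y x‖) ^ i * M i) → ∀ k : ℕ,
      a * ‖iteratedFDeriv ℝ k (fun z => (F (normSqC y z))⁻¹) x‖ ≤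
        CF * (κ * σ') ^ k * k.factorial * M k * ‖y x‖ ^ 2 := by
    intro x hx hx0 a ha hai k
    have ht := norm_pos_iff.2 hx0
    have hMk := hM0 k
    rcases ha.eq_or_lt with rfl | ha
    · rw [zero_mul]; positivity
    obtain ⟨hd, hb⟩ := hF ‖y x‖ ht
    have h1 := (hcomp x hx hx0 (fun z => (F z)⁻¹)
      (CF * ((κ * ‖y x‖) ^ k * M k * ‖y x‖ ^ 2) / a) (hinv x hx hx0)
      fun z hz => by rw [le_div_iff₀' ha]; exact (hb z hz).2 a hai k).2 k
    rw [← le_div_iff₀' ha]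
    refine h1.trans_eq ?_
    rw [mul_pow, mul_pow, div_pow]
    field_simp
  have hinvan : ∀ x ∈ U, y x ≠ 0 → AnalyticAt ℝ (fun z => (F (normSqC y z))⁻¹) x := by
    intro x hx hx0
    have hcont := ((hinv x hx hx0).continuousOn).norm
    obtain ⟨B, hB⟩ := (isCompact_closedBall ((‖y x‖ : ℂ) ^ 2) (c * ‖y x‖ ^ 2)).bddAbove_image hcont
    exact (hcomp x hx hx0 _ B (hinv x hx hx0) fun z hz => hB ⟨z, hz, rfl⟩).1
  have hwan : ∀ x ∈ U, y x ≠ 0 → AnalyticAt ℝ (fun z => F (normSqC y z)) x := by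
    intro x hx hx0
    have := (hinvan x hx hx0).fun_inv (inv_ne_zero (hF0 _))
    simpa only [inv_inv] using this
  have huU : ContDiffOn ℝ (⊤ : ℕ∞) u Ω := hu.1
  set S := U ∩ y ⁻¹' {0}ᶜ with hS
  have hSo : IsOpen S := hyc.isOpen_inter_preimage hU isOpen_compl_singleton
  have husm : ∀ x ∈ U, y x ≠ 0 → ∀ j i : ℕ,
      ‖iteratedFDeriv ℝ j u x‖ / (Cu * (2 * A * σ) ^ j * j.factorial * M j) ≤
        (2 * A * σ * L * ‖y x‖) ^ i * M i := by
    intro x hx hx0 j i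
    obtain ⟨-, -, ⟨x', hx'X, hx'b, hxx'⟩, -⟩ := hy x (hUε hx)
    have hseg : ∀ s ∈ Set.Icc (0 : ℝ) 1, x' + s • (x - x') ∈ Ω := fun s hs =>
      hballΩ ((convex_ball 0 ε').add_smul_sub_mem hx'b (hUε' hx) hs)
    exact hA.norm_iteratedFDeriv_le_of_flat hCu hσ hL (norm_pos_iff.2 hx0) hxx'
      (fun s hs => huU.contDiffAt (hΩ.mem_nhds (hseg s hs)))
      (fun k => huflat.iteratedFDeriv_eq_zero hΩ hx'X (hXΩ hx'X) k)
      (fun k s hs => hub k _ (hseg s hs)) j i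
  have hvbd : ∀ x ∈ U, y x ≠ 0 → ∀ k : ℕ,
      ‖iteratedFDeriv ℝ k (fun z => u z * (F (normSqC y z))⁻¹) x‖ ≤
        (Cu * CF) * (2 * (2 * A * σ + κ * σ')) ^ k * k.factorial * M k * ‖y x‖ ^ 2 := by
    intro x hx hx0 k
    have h1 := norm_iteratedFDeriv_mul_le_of_bounds hSo (f := u)
      (g := fun z => (F (normSqC y z))⁻¹) (huU.mono (Set.inter_subset_left.trans hUΩ))
      (fun z hz => (hinvan z hz.1 hz.2).contDiffAt.contDiffWithinAt) (x := x) ⟨hx, hx0⟩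
      (D := Cu * CF * ‖y x‖ ^ 2) (s := 2 * A * σ + κ * σ') (by positivity) (by positivity) hM0
      (fun j l => ?_) k
    · exact h1.trans_eq (by ring)
    have hMj := hM0 j
    have hMl := hM0 l
    have h2 := hinvbd x hx hx0 _ (by positivity) (husm x hx hx0 j) l
    rw [div_mul_eq_mul_div, div_le_iff₀ (by positivity)] at h2
    refine h2.trans ?_
    calc _ = Cu * CF * ‖y x‖ ^ 2 * ((2 * A * σ) ^ j * (κ * σ') ^ l) *
          (j.factorial * l.factorial) * (M j * M l) := by ring
      _ ≤ _ := by
        have h3 : 0 ≤ κ * σ' := by positivity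
        have h4 : 0 ≤ 2 * A * σ := by positivity
        rw [pow_add]
        gcongr
        · linarith
        · linarith
        · exact hA.mul_le j l
  have hval : ∀ x ∈ U, y x = 0 → u x = 0 := by
    intro x hx h
    have h1 := huflat.iteratedFDeriv_eq_zero hΩ ((hy x (hUε hx)).1.1 h) (hUΩ hx) 0
    have h2 := norm_iteratedFDeriv_zero (𝕜 := ℝ) (f := u) (x := x)
    rw [h1, norm_zero] at h2
    exact norm_eq_zero.1 h2.symm
  have hv := classCMOn_and_flatOn_of_bounds hM0 hU hyc.norm hρ hρ1 hXU
    (f := fun x => if y x = 0 then 0 else u x * (F (normSqC y x))⁻¹)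
    (fun x hx h => ContDiffAt.congr_of_eventuallyEq
      ((huU.contDiffAt (hΩ.mem_nhds (hUΩ hx))).mul (hinvan x hx (norm_ne_zero_iff.1 h)).contDiffAt)
      (eventuallyEq_ite_of_ne_zero hU hyc _ hx (norm_ne_zero_iff.1 h)))
    (fun x _ h => if_pos (norm_eq_zero.1 h))
    (C := Cu * CF) (σ := 2 * (2 * A * σ + κ * σ')) (by positivity) (by positivity)
    (fun k x hx h => by
      rw [((eventuallyEq_ite_of_ne_zero hU hyc _ hx (norm_ne_zero_iff.1 h)).iteratedFDeriv ℝ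
        k).eq_of_nhds]
      exact hvbd x hx (norm_ne_zero_iff.1 h) k)
  have hw := classCMOn_and_flatOn_of_bounds hM0 hU hyc.norm hρ hρ1 hXU
    (f := fun x => if y x = 0 then 0 else F (normSqC y x))
    (fun x hx h => ContDiffAt.congr_of_eventuallyEq
      (hwan x hx (norm_ne_zero_iff.1 h)).contDiffAt
      (eventuallyEq_ite_of_ne_zero hU hyc _ hx (norm_ne_zero_iff.1 h)))
    (fun x _ h => if_pos (norm_eq_zero.1 h))
    (C := CF) (σ := κ * σ') (by positivity) (by positivity)
    (fun k x hx h => by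
      rw [((eventuallyEq_ite_of_ne_zero hU hyc _ hx (norm_ne_zero_iff.1 h)).iteratedFDeriv ℝ
        k).eq_of_nhds]
      exact hwbd x hx (norm_ne_zero_iff.1 h) k)
  refine ⟨U, hU, Metric.mem_ball_self (lt_min hε hε'), hUΩ, _, _, hv.1, hv.2, hw.1, hw.2,
    fun x hx => ?_⟩
  by_cases h : y x = 0
  · simp [h, hval x hx h]
  · simp [h, hF0]
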